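/- arXiv:math/0507506 — 3 statements merged into one kernel-verified Lean document; each statement's English description precedes it below -/
import Mathlib

section
/- For all α, β ∈ π, the following identities hold on A_{αβ}²: (Δ_{α,β} ⊗ id) ∘ r_{αβ} = (id ⊗ r_β) ∘ Φ^l_{α,β}, and (id ⊗ Δ_{α,β}) ∘ t_{αβ} = (t_α ⊗ id) ∘ Φ^r_{α,β}. -/
open TensorProduct

/-- `A_α² = ker(m_α : A_α ⊗ A_α → A_α)`. -/
noncomputable def A2sub (k R : Type) [Field k] [Ring R] [Algebra k R] :
    Submodule k (R ⊗[k] R) := LinearMap.ker (LinearMap.mul' k R)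

/-- The left `R`-action on `R ⊗ R`: `c • (a ⊗ b) = (c*a) ⊗ b`, as a bilinear map. -/
noncomputable def lmulTb (k R : Type) [Field k] [Ring R] [Algebra k R] :
    R →ₗ[k] (R ⊗[k] R) →ₗ[k] R ⊗[k] R :=
  (LinearMap.rTensorHom R) ∘ₗ (LinearMap.mul k R)

/-- The right `R`-action on `R ⊗ R`: `(a ⊗ b) • c = a ⊗ (b*c)`, as a bilinear map. -/
noncomputable def rmulTb (k R : Type) [Field k] [Ring R] [Algebra k R] :
    R →ₗ[k] (R ⊗[k] R) →ₗ[k] R ⊗[k] R :=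
  (LinearMap.lTensorHom R) ∘ₗ (LinearMap.mul k R).flip

lemma lmulTb_mem_A2sub (k R : Type) [Field k] [Ring R] [Algebra k R]
    (c : R) (q : R ⊗[k] R) (hq : q ∈ A2sub k R) : lmulTb k R c q ∈ A2sub k R := by
  have h : (LinearMap.mul' k R) ∘ₗ (lmulTb k R c)
      = (LinearMap.mulLeft k c) ∘ₗ (LinearMap.mul' k R) := by
    apply TensorProduct.ext'
    intro x y
    simp [lmulTb, mul_assoc]
  simp only [A2sub, LinearMap.mem_ker] at hq ⊢
  have := LinearMap.congr_fun h q
  simp only [LinearMap.comp_apply] at this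
  rw [this, hq]
  simp

lemma rmulTb_mem_A2sub (k R : Type) [Field k] [Ring R] [Algebra k R]
    (c : R) (q : R ⊗[k] R) (hq : q ∈ A2sub k R) : rmulTb k R c q ∈ A2sub k R := by
  have h : (LinearMap.mul' k R) ∘ₗ (rmulTb k R c)
      = (LinearMap.mulRight k c) ∘ₗ (LinearMap.mul' k R) := by
    apply TensorProduct.ext'
    intro x y
    simp [rmulTb, mul_assoc]
  simp only [A2sub, LinearMap.mem_ker] at hq ⊢
  have := LinearMap.congr_fun h q
  simp only [LinearMap.comp_apply] at this
  rw [this, hq]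
  simp

/-- The map `D : R → R ⊗ R`, `D b = 1 ⊗ b - b ⊗ 1`. -/
noncomputable def Dmap (k R : Type) [Field k] [Ring R] [Algebra k R] :
    R →ₗ[k] R ⊗[k] R :=
  (TensorProduct.mk k R R) 1 - (TensorProduct.mk k R R).flip 1

lemma Dmap_mem_A2sub (k R : Type) [Field k] [Ring R] [Algebra k R] (b : R) :
    Dmap k R b ∈ A2sub k R := by
  simp [Dmap, A2sub, LinearMap.mem_ker]

/-- `Φˡ_{α,β} : q ↦ Σ a_k c_k ⊗ b_k ⊗ d_k` where `(Δ ⊗ Δ)(q) = Σ a_k ⊗ b_k ⊗ c_k ⊗ d_k`. -/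
noncomputable def PhiL {k : Type} [Field k] {G : Type} [Group G]
    (A : G → Type) [∀ α, Ring (A α)] [∀ α, Algebra k (A α)]
    (Δ : ∀ α β γ : G, α * β = γ → (A γ →ₐ[k] A α ⊗[k] A β))
    (α β γ : G) (h : α * β = γ) :
    (A γ ⊗[k] A γ) →ₗ[k] A α ⊗[k] (A β ⊗[k] A β) :=
  (TensorProduct.map (LinearMap.mul' k (A α)) LinearMap.id) ∘ₗ
    (TensorProduct.tensorTensorTensorComm k (A α) (A β) (A α) (A β)).toLinearMap ∘ₗ
    (TensorProduct.map (Δ α β γ h).toLinearMap (Δ α β γ h).toLinearMap)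

/-- `Φʳ_{α,β} : q ↦ Σ a_k ⊗ c_k ⊗ b_k d_k` where `(Δ ⊗ Δ)(q) = Σ a_k ⊗ b_k ⊗ c_k ⊗ d_k`. -/
noncomputable def PhiR {k : Type} [Field k] {G : Type} [Group G]
    (A : G → Type) [∀ α, Ring (A α)] [∀ α, Algebra k (A α)]
    (Δ : ∀ α β γ : G, α * β = γ → (A γ →ₐ[k] A α ⊗[k] A β))
    (α β γ : G) (h : α * β = γ) :
    (A γ ⊗[k] A γ) →ₗ[k] (A α ⊗[k] A α) ⊗[k] A β :=
  (TensorProduct.map LinearMap.id (LinearMap.mul' k (A β))) ∘ₗ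
    (TensorProduct.tensorTensorTensorComm k (A α) (A β) (A α) (A β)).toLinearMap ∘ₗ
    (TensorProduct.map (Δ α β γ h).toLinearMap (Δ α β γ h).toLinearMap)

/-- `r_α : A_α ⊗ A_α → A_α ⊗ A₁`, `a ⊗ b ↦ (a ⊗ 1)·Δ_{α,1}(b)`. -/
noncomputable def rmap {k : Type} [Field k] {G : Type} [Group G]
    (A : G → Type) [∀ α, Ring (A α)] [∀ α, Algebra k (A α)]
    (Δ : ∀ α β γ : G, α * β = γ → (A γ →ₐ[k] A α ⊗[k] A β))
    (α : G) : (A α ⊗[k] A α) →ₗ[k] A α ⊗[k] A 1 :=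
  (LinearMap.rTensor (A 1) (LinearMap.mul' k (A α))) ∘ₗ
    (TensorProduct.assoc k (A α) (A α) (A 1)).symm.toLinearMap ∘ₗ
    (LinearMap.lTensor (A α) (Δ α 1 α (mul_one α)).toLinearMap)

/-- `t_α : A_α ⊗ A_α → A₁ ⊗ A_α`, `a ⊗ b ↦ (1 ⊗ a)·Δ_{1,α}(b)`. -/
noncomputable def tmap {k : Type} [Field k] {G : Type} [Group G]
    (A : G → Type) [∀ α, Ring (A α)] [∀ α, Algebra k (A α)]
    (Δ : ∀ α β γ : G, α * β = γ → (A γ →ₐ[k] A α ⊗[k] A β))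
    (α : G) : (A α ⊗[k] A α) →ₗ[k] A 1 ⊗[k] A α :=
  (LinearMap.lTensor (A 1) (LinearMap.mul' k (A α))) ∘ₗ
    (TensorProduct.leftComm k (A α) (A 1) (A α)).toLinearMap ∘ₗ
    (LinearMap.lTensor (A α) (Δ 1 α α (one_mul α)).toLinearMap)

section Helpers

variable {k : Type} [Field k] {G : Type} [Group G]
  (A : G → Type) [∀ α, Ring (A α)] [∀ α, Algebra k (A α)]
  (Δ : ∀ α β γ : G, α * β = γ → (A γ →ₐ[k] A α ⊗[k] A β))

lemma rmap_tmul (α : G) (a b : A α) :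
    rmap A Δ α (a ⊗ₜ b) = (a ⊗ₜ[k] (1 : A 1)) * Δ α 1 α (mul_one α) b := by
  simp only [rmap, LinearMap.comp_apply, LinearMap.lTensor_tmul, AlgHom.toLinearMap_apply,
    LinearEquiv.coe_coe]
  induction Δ α 1 α (mul_one α) b with
  | zero => simp
  | tmul x y => simp
  | add x y hx hy => simp only [TensorProduct.tmul_add, map_add, mul_add, hx, hy]

lemma tmap_tmul (α : G) (a b : A α) :
    tmap A Δ α (a ⊗ₜ b) = ((1 : A 1) ⊗ₜ[k] a) * Δ 1 α α (one_mul α) b := by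
  simp only [tmap, LinearMap.comp_apply, LinearMap.lTensor_tmul, AlgHom.toLinearMap_apply,
    LinearEquiv.coe_coe]
  induction Δ 1 α α (one_mul α) b with
  | zero => simp
  | tmul x y => simp
  | add x y hx hy => simp only [TensorProduct.tmul_add, map_add, mul_add, hx, hy]

lemma lTensor_rmap_tensorTensorTensorComm (α β : G) (u v : A α ⊗[k] A β) :
    LinearMap.lTensor (A α) (rmap A Δ β)
        (TensorProduct.map (LinearMap.mul' k (A α)) LinearMap.id
          (TensorProduct.tensorTensorTensorComm k (A α) (A β) (A α) (A β) (u ⊗ₜ v)))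
      = Algebra.TensorProduct.assoc k k k (A α) (A β) (A 1) (u ⊗ₜ 1)
        * Algebra.TensorProduct.map (AlgHom.id k (A α)) (Δ β 1 β (mul_one β)) v := by
  induction u with
  | zero => simp
  | add x y hx hy => simp only [TensorProduct.add_tmul, map_add, add_mul, hx, hy]
  | tmul a b =>
    induction v with
    | zero => simp
    | add x y hx hy => simp only [TensorProduct.tmul_add, map_add, mul_add, hx, hy]
    | tmul c d => simp [rmap_tmul]

lemma assoc_rTensor_tmap_tensorTensorTensorComm (α β : G) (u v : A α ⊗[k] A β) :
    TensorProduct.assoc k (A 1) (A α) (A β) (LinearMap.rTensor (A β) (tmap A Δ α)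
        (TensorProduct.map LinearMap.id (LinearMap.mul' k (A β))
          (TensorProduct.tensorTensorTensorComm k (A α) (A β) (A α) (A β) (u ⊗ₜ v))))
      = ((1 : A 1) ⊗ₜ[k] u) * TensorProduct.assoc k (A 1) (A α) (A β)
          (Algebra.TensorProduct.map (Δ 1 α α (one_mul α)) (AlgHom.id k (A β)) v) := by
  induction u with
  | zero => simp
  | add x y hx hy =>
    simp only [TensorProduct.add_tmul, TensorProduct.tmul_add, map_add, add_mul, hx, hy]
  | tmul a b =>
    induction v with
    | zero => simp
    | add x y hx hy => simp only [TensorProduct.tmul_add, map_add, mul_add, hx, hy]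
    | tmul c d =>
      simp only [TensorProduct.tensorTensorTensorComm_tmul, TensorProduct.map_tmul,
        LinearMap.id_apply, LinearMap.mul'_apply, LinearMap.rTensor_tmul, tmap_tmul,
        Algebra.TensorProduct.map_tmul, AlgHom.id_apply]
      induction Δ 1 α α (one_mul α) c with
      | zero => simp
      | tmul x y => simp
      | add x y hx hy => simp only [TensorProduct.add_tmul, map_add, mul_add, hx, hy]

variable {A Δ} in
lemma coassoc_of_eq
    (hcoassoc : ∀ (α β γ : G) (x : A (α * β * γ)),
      (TensorProduct.assoc k (A α) (A β) (A γ))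
          ((Algebra.TensorProduct.map (Δ α β (α * β) rfl) (AlgHom.id k (A γ)))
            ((Δ (α * β) γ (α * β * γ) rfl) x))
        = (Algebra.TensorProduct.map (AlgHom.id k (A α)) (Δ β γ (β * γ) rfl))
            ((Δ α (β * γ) (α * β * γ) (mul_assoc α β γ).symm) x))
    {α β γ δ η ζ : G} (hδ : α * β = δ) (hη : β * γ = η) (hl : δ * γ = ζ) (hr : α * η = ζ)
    (x : A ζ) :
    TensorProduct.assoc k (A α) (A β) (A γ)
        (Algebra.TensorProduct.map (Δ α β δ hδ) (AlgHom.id k (A γ)) (Δ δ γ ζ hl x))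
      = Algebra.TensorProduct.map (AlgHom.id k (A α)) (Δ β γ η hη) (Δ α η ζ hr x) := by
  subst hδ hη hl
  exact hcoassoc α β γ x

end Helpers

/-- On `A_{αβ}²` one has
`(Δ_{α,β} ⊗ id) ∘ r_{αβ} = (id ⊗ r_β) ∘ Φˡ_{α,β}` and
`(id ⊗ Δ_{α,β}) ∘ t_{αβ} = (t_α ⊗ id) ∘ Φʳ_{α,β}`. -/
theorem r_t_intertwine_Phi
    {k : Type} [Field k] {G : Type} [Group G]
    (A : G → Type) [∀ α, Ring (A α)] [∀ α, Algebra k (A α)]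
    (Δ : ∀ α β γ : G, α * β = γ → (A γ →ₐ[k] A α ⊗[k] A β))
    (ε : A 1 →ₐ[k] k)
    (S : ∀ α β : G, α⁻¹ = β → (A α →ₗ[k] A β))
    (hcoassoc : ∀ (α β γ : G) (x : A (α * β * γ)),
      (TensorProduct.assoc k (A α) (A β) (A γ))
          ((Algebra.TensorProduct.map (Δ α β (α * β) rfl) (AlgHom.id k (A γ)))
            ((Δ (α * β) γ (α * β * γ) rfl) x))
        = (Algebra.TensorProduct.map (AlgHom.id k (A α)) (Δ β γ (β * γ) rfl))
            ((Δ α (β * γ) (α * β * γ) (mul_assoc α β γ).symm) x))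
    (hcounit₁ : ∀ (α : G) (x : A α),
      (TensorProduct.rid k (A α)) ((LinearMap.lTensor (A α) ε.toLinearMap)
        ((Δ α 1 α (mul_one α)) x)) = x)
    (hcounit₂ : ∀ (α : G) (x : A α),
      (TensorProduct.lid k (A α)) ((LinearMap.rTensor (A α) ε.toLinearMap)
        ((Δ 1 α α (one_mul α)) x)) = x)
    (hantipode₁ : ∀ (α : G) (x : A 1),
      (LinearMap.mul' k (A α)) ((LinearMap.rTensor (A α) (S α⁻¹ α (inv_inv α)))
        ((Δ α⁻¹ α 1 (inv_mul_cancel α)) x)) = ε x • 1)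
    (hantipode₂ : ∀ (α : G) (x : A 1),
      (LinearMap.mul' k (A α)) ((LinearMap.lTensor (A α) (S α⁻¹ α (inv_inv α)))
        ((Δ α α⁻¹ 1 (mul_inv_cancel α)) x)) = ε x • 1) :
    ∀ (α β : G) (q : A (α * β) ⊗[k] A (α * β)), q ∈ A2sub k (A (α * β)) →
      (TensorProduct.assoc k (A α) (A β) (A 1))
          ((LinearMap.rTensor (A 1) (Δ α β (α * β) rfl).toLinearMap)
            (rmap A Δ (α * β) q))
        = (LinearMap.lTensor (A α) (rmap A Δ β)) (PhiL A Δ α β (α * β) rfl q)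
      ∧ (LinearMap.lTensor (A 1) (Δ α β (α * β) rfl).toLinearMap)
          (tmap A Δ (α * β) q)
        = (TensorProduct.assoc k (A 1) (A α) (A β))
            ((LinearMap.rTensor (A β) (tmap A Δ α)) (PhiR A Δ α β (α * β) rfl q)) := by
  intro α β q hq
  clear hq
  constructor
  · induction q with
    | zero => simp
    | add x y hx hy => simp only [map_add, hx, hy]
    | tmul a b =>
      have h := coassoc_of_eq hcoassoc (α := α) (β := β) (γ := 1) rfl (mul_one β)
        (mul_one (α * β)) rfl b
      rw [rmap_tmul]
      simp only [PhiL, LinearMap.comp_apply, TensorProduct.map_tmul, AlgHom.toLinearMap_apply,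
        LinearEquiv.coe_coe]
      rw [lTensor_rmap_tensorTensorTensorComm, ← h]
      change Algebra.TensorProduct.assoc k k k (A α) (A β) (A 1)
        (Algebra.TensorProduct.map (Δ α β (α * β) rfl) (AlgHom.id k (A 1)) _) = _
      rw [map_mul, map_mul]
      simp only [Algebra.TensorProduct.map_tmul, map_one]
      rfl
  · induction q with
    | zero => simp
    | add x y hx hy => simp only [map_add, hx, hy]
    | tmul a b =>
      have h := coassoc_of_eq hcoassoc (α := 1) (β := α) (γ := β) (one_mul α) rfl
        rfl (one_mul (α * β)) b
      rw [tmap_tmul]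
      simp only [PhiR, LinearMap.comp_apply, TensorProduct.map_tmul, AlgHom.toLinearMap_apply,
        LinearEquiv.coe_coe]
      rw [assoc_rTensor_tmap_tensorTensorTensorComm, h]
      change Algebra.TensorProduct.map (AlgHom.id k (A 1)) (Δ α β (α * β) rfl) _ = _
      rw [map_mul]
      simp only [Algebra.TensorProduct.map_tmul, map_one]
end

section
/- Assume each antipode S_α is bijective. For any α ∈ π and q ∈ A_α²: q is left invariant (i.e. Φ^l_{1,α}(q) = 1₁ ⊗ q) if and only if q = r_α⁻¹(1_α ⊗ x) for some x ∈ ker ε ⊆ A₁; and q is right invariant (i.e. Φ^r_{α,1}(q) = q ⊗ 1₁) if and only if q = t_α⁻¹(y ⊗ 1_α) for some y ∈ ker ε ⊆ A₁. -/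
open TensorProduct

section Auxiliary

variable {k B C H : Type} [Field k] [Ring B] [Algebra k B] [Ring C] [Algebra k C]
  [Ring H] [Algebra k H]

/-- The linear map `a ⊗ x ⊗ b ↦ S(a a') x x' S(b') S(b)`, for `a' ⊗ x' ⊗ b'` the second
argument. -/
noncomputable def antipodeSandwich (S : B →ₗ[k] C) :
    (B ⊗[k] (C ⊗[k] B)) ⊗[k] (B ⊗[k] (C ⊗[k] B)) →ₗ[k] C :=
  LinearMap.mul' k C ∘ₗ
    TensorProduct.map (S ∘ₗ LinearMap.mul' k B)
      (LinearMap.mul' k C ∘ₗ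
        TensorProduct.map (LinearMap.mul' k C)
          (LinearMap.mul' k C ∘ₗ (TensorProduct.comm k C C).toLinearMap ∘ₗ
            TensorProduct.map S S) ∘ₗ
        (TensorProduct.tensorTensorTensorComm k C B C B).toLinearMap) ∘ₗ
    (TensorProduct.tensorTensorTensorComm k B (C ⊗[k] B) B (C ⊗[k] B)).toLinearMap

lemma antipodeSandwich_tmul (S : B →ₗ[k] C) (a a' b b' : B) (x x' : C) :
    antipodeSandwich S ((a ⊗ₜ (x ⊗ₜ b)) ⊗ₜ (a' ⊗ₜ (x' ⊗ₜ b')))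
      = S (a * a') * ((x * x') * (S b' * S b)) := by
  simp [antipodeSandwich]

lemma antipodeSandwich_right (S : B →ₗ[k] C) (a a' : B) (u v : C ⊗[k] B) (e e' : k)
    (hu : LinearMap.mul' k C (LinearMap.lTensor C S u) = e • 1)
    (hv : LinearMap.mul' k C (LinearMap.lTensor C S v) = e' • 1) :
    antipodeSandwich S ((a ⊗ₜ u) ⊗ₜ (a' ⊗ₜ v)) = (e * e') • S (a * a') := by
  have key : antipodeSandwich S ((a ⊗ₜ u) ⊗ₜ (a' ⊗ₜ v))
      = e' • (S (a * a') * LinearMap.mul' k C (LinearMap.lTensor C S u)) := by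
    clear hu
    induction u using TensorProduct.induction_on with
    | zero => simp
    | add u₁ u₂ h₁ h₂ => simp [tmul_add, add_tmul, h₁, h₂, mul_add]
    | tmul x b =>
      have : antipodeSandwich S ((a ⊗ₜ (x ⊗ₜ b)) ⊗ₜ (a' ⊗ₜ v))
          = S (a * a') * (x * LinearMap.mul' k C (LinearMap.lTensor C S v) * S b) := by
        clear hv
        induction v using TensorProduct.induction_on with
        | zero => simp
        | add v₁ v₂ h₁ h₂ => simp [tmul_add, h₁, h₂, mul_add, add_mul]
        | tmul x' b' => simp [antipodeSandwich_tmul, mul_assoc]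
      rw [this, hv]
      simp
  rw [key, hu]
  simp [smul_smul, mul_comm]

lemma antipodeSandwich_left (S : B →ₗ[k] C) (b b' : B) (u v : B ⊗[k] C) (e : k)
    (huv : LinearMap.mul' k C (LinearMap.rTensor C S (u * v)) = e • 1) :
    antipodeSandwich S (TensorProduct.assoc k B C B (u ⊗ₜ b) ⊗ₜ
      TensorProduct.assoc k B C B (v ⊗ₜ b')) = e • (S b' * S b) := by
  have key : antipodeSandwich S (TensorProduct.assoc k B C B (u ⊗ₜ b) ⊗ₜ
      TensorProduct.assoc k B C B (v ⊗ₜ b'))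
      = LinearMap.mul' k C (LinearMap.rTensor C S (u * v)) * (S b' * S b) := by
    clear huv
    induction u using TensorProduct.induction_on with
    | zero => simp
    | add u₁ u₂ h₁ h₂ => simp [add_tmul, h₁, h₂, add_mul]
    | tmul a x =>
      induction v using TensorProduct.induction_on with
      | zero => simp
      | add v₁ v₂ h₁ h₂ => simp only [map_add, tmul_add, add_tmul, h₁, h₂, mul_add, add_mul]
      | tmul a' x' => simp [antipodeSandwich_tmul, mul_assoc]
  rw [key, huv]
  simp

/-- The antipode of a Hopf group-coalgebra reverses products. -/
lemma antipode_map_mul (δr : B →ₐ[k] B ⊗[k] H) (δl : B →ₐ[k] H ⊗[k] B)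
    (Δ₁ : H →ₐ[k] C ⊗[k] B) (Δ₂ : H →ₐ[k] B ⊗[k] C) (ε : H →ₐ[k] k) (S : B →ₗ[k] C)
    (hco : ∀ b, TensorProduct.assoc k B C B (LinearMap.rTensor B Δ₂.toLinearMap (δl b))
      = LinearMap.lTensor B Δ₁.toLinearMap (δr b))
    (hr : ∀ b, TensorProduct.rid k B (LinearMap.lTensor B ε.toLinearMap (δr b)) = b)
    (hl : ∀ b, TensorProduct.lid k B (LinearMap.rTensor B ε.toLinearMap (δl b)) = b)
    (hS₁ : ∀ x, LinearMap.mul' k C (LinearMap.lTensor C S (Δ₁ x)) = ε x • 1)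
    (hS₂ : ∀ x, LinearMap.mul' k C (LinearMap.rTensor C S (Δ₂ x)) = ε x • 1)
    (a b : B) : S (a * b) = S b * S a := by
  have h₁ : ∀ u v : B ⊗[k] H, antipodeSandwich S
      (LinearMap.lTensor B Δ₁.toLinearMap u ⊗ₜ LinearMap.lTensor B Δ₁.toLinearMap v)
      = S (TensorProduct.rid k B (LinearMap.lTensor B ε.toLinearMap u) *
          TensorProduct.rid k B (LinearMap.lTensor B ε.toLinearMap v)) := by
    intro u v
    induction u using TensorProduct.induction_on with
    | zero => simp
    | add u₁ u₂ h₁ h₂ => simp only [map_add, add_tmul, h₁, h₂, add_mul]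
    | tmul a x =>
      induction v using TensorProduct.induction_on with
      | zero => simp
      | add v₁ v₂ h₁ h₂ => simp only [map_add, tmul_add, h₁, h₂, mul_add]
      | tmul a' x' =>
        simp only [LinearMap.lTensor_tmul, AlgHom.toLinearMap_apply]
        rw [antipodeSandwich_right S a a' _ _ _ _ (hS₁ x) (hS₁ x')]
        simp [smul_smul, mul_comm]
  have h₂ : ∀ u v : H ⊗[k] B, antipodeSandwich S
      (TensorProduct.assoc k B C B (LinearMap.rTensor B Δ₂.toLinearMap u) ⊗ₜ
        TensorProduct.assoc k B C B (LinearMap.rTensor B Δ₂.toLinearMap v))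
      = S (TensorProduct.lid k B (LinearMap.rTensor B ε.toLinearMap v)) *
          S (TensorProduct.lid k B (LinearMap.rTensor B ε.toLinearMap u)) := by
    intro u v
    induction u using TensorProduct.induction_on with
    | zero => simp
    | add u₁ u₂ h₁ h₂ => simp only [map_add, add_tmul, h₁, h₂, mul_add]
    | tmul x a =>
      induction v using TensorProduct.induction_on with
      | zero => simp
      | add v₁ v₂ h₁ h₂ => simp only [map_add, tmul_add, h₁, h₂, add_mul]
      | tmul x' a' =>
        simp only [LinearMap.rTensor_tmul, AlgHom.toLinearMap_apply]
        rw [antipodeSandwich_left S a a' _ _ (ε (x * x')) (by rw [← map_mul, hS₂])]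
        simp [smul_smul]
  have := h₁ (δr a) (δr b)
  rw [← hco, ← hco, h₂, hr, hr, hl, hl] at this
  exact this.symm

/-- `a ⊗ x ↦ (a ⊗ 1) · (s ⊗ id)(Δ₁ x)` inverts `a ⊗ b ↦ (a ⊗ 1) · δr b`. -/
lemma mul_comul_injective (δr : B →ₐ[k] B ⊗[k] H) (δl : B →ₐ[k] H ⊗[k] B)
    (Δ₁ : H →ₐ[k] C ⊗[k] B) (Δ₂ : H →ₐ[k] B ⊗[k] C) (ε : H →ₐ[k] k) (s : C →ₗ[k] B)
    (hco : ∀ b, TensorProduct.assoc k B C B (LinearMap.rTensor B Δ₂.toLinearMap (δl b))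
      = LinearMap.lTensor B Δ₁.toLinearMap (δr b))
    (hl : ∀ b, TensorProduct.lid k B (LinearMap.rTensor B ε.toLinearMap (δl b)) = b)
    (hs : ∀ x, LinearMap.mul' k B (LinearMap.lTensor B s (Δ₂ x)) = ε x • 1) :
    Function.Injective (LinearMap.rTensor H (LinearMap.mul' k B) ∘ₗ
      (TensorProduct.assoc k B B H).symm.toLinearMap ∘ₗ LinearMap.lTensor B δr.toLinearMap) := by
  let μ : B ⊗[k] (C ⊗[k] B) →ₗ[k] B ⊗[k] B :=
    LinearMap.rTensor B (LinearMap.mul' k B) ∘ₗ (TensorProduct.assoc k B B B).symm.toLinearMap ∘ₗ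
      LinearMap.lTensor B (LinearMap.rTensor B s)
  have hμ : ∀ (a : B) (w : B ⊗[k] (C ⊗[k] B)),
      μ (LinearMap.rTensor _ (LinearMap.mulLeft k a) w)
        = LinearMap.rTensor B (LinearMap.mulLeft k a) (μ w) := by
    intro a w
    rw [← LinearMap.comp_apply, ← LinearMap.comp_apply]
    congr 1
    ext
    simp [μ, mul_assoc]
  have hμδ : ∀ b, μ (LinearMap.lTensor B Δ₁.toLinearMap (δr b)) = 1 ⊗ₜ b := by
    intro b
    have : ∀ u : H ⊗[k] B,
        μ (TensorProduct.assoc k B C B (LinearMap.rTensor B Δ₂.toLinearMap u))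
          = 1 ⊗ₜ TensorProduct.lid k B (LinearMap.rTensor B ε.toLinearMap u) := by
      intro u
      induction u using TensorProduct.induction_on with
      | zero => simp
      | add u₁ u₂ h₁ h₂ => simp only [map_add, tmul_add, h₁, h₂]
      | tmul x b =>
        have h : ∀ v : B ⊗[k] C, μ (TensorProduct.assoc k B C B (v ⊗ₜ b))
            = LinearMap.mul' k B (LinearMap.lTensor B s v) ⊗ₜ b := by
          intro v
          induction v using TensorProduct.induction_on with
          | zero => simp
          | add v₁ v₂ h₁ h₂ => simp only [map_add, add_tmul, h₁, h₂]
          | tmul a c => simp [μ]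
        simp [h, hs, smul_tmul]
    rw [← hco, this, hl]
  apply Function.LeftInverse.injective (g := μ ∘ₗ LinearMap.lTensor B Δ₁.toLinearMap)
  intro q
  induction q using TensorProduct.induction_on with
  | zero => simp
  | add q₁ q₂ h₁ h₂ => rw [map_add, map_add, h₁, h₂]
  | tmul a b =>
    have h : ∀ u : B ⊗[k] H, LinearMap.lTensor B Δ₁.toLinearMap
        (LinearMap.rTensor H (LinearMap.mul' k B) ((TensorProduct.assoc k B B H).symm (a ⊗ₜ u)))
        = LinearMap.rTensor _ (LinearMap.mulLeft k a) (LinearMap.lTensor B Δ₁.toLinearMap u) := by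
      intro u
      induction u using TensorProduct.induction_on with
      | zero => simp
      | add u₁ u₂ h₁ h₂ => simp only [map_add, tmul_add, h₁, h₂]
      | tmul b x => simp
    simp [h, hμ, hμδ]

/-- Coinvariants of `B ⊗ V` under the coaction of `H` on `B` lie in `1 ⊗ V`. -/
lemma exists_eq_one_tmul_of_coinvariant {V : Type} [AddCommGroup V] [Module k V] [Nontrivial B]
    (δr : B →ₐ[k] B ⊗[k] H) (δl : B →ₐ[k] H ⊗[k] B)
    (Δ₁ : H →ₐ[k] C ⊗[k] B) (Δ₂ : H →ₐ[k] B ⊗[k] C) (ε : H →ₐ[k] k) (s : C →ₗ[k] B)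
    (hco : ∀ b, TensorProduct.assoc k B C B (LinearMap.rTensor B Δ₂.toLinearMap (δl b))
      = LinearMap.lTensor B Δ₁.toLinearMap (δr b))
    (hr : ∀ b, TensorProduct.rid k B (LinearMap.lTensor B ε.toLinearMap (δr b)) = b)
    (hs : ∀ x, LinearMap.mul' k B (LinearMap.rTensor B s (Δ₁ x)) = ε x • 1)
    (p : B ⊗[k] V)
    (hp : TensorProduct.assoc k H B V (LinearMap.rTensor V δl.toLinearMap p) = 1 ⊗ₜ p) :
    ∃ x : V, p = 1 ⊗ₜ x := by
  obtain ⟨f, hf⟩ := Module.Projective.exists_dual_eq_one k (one_ne_zero (α := B))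
  let F : H ⊗[k] B →ₗ[k] B := (TensorProduct.rid k B).toLinearMap ∘ₗ
    LinearMap.lTensor B (f ∘ₗ LinearMap.mul' k B ∘ₗ LinearMap.rTensor B s) ∘ₗ
    (TensorProduct.assoc k B C B).toLinearMap ∘ₗ LinearMap.rTensor B Δ₂.toLinearMap
  have hFδ : F ∘ₗ δl.toLinearMap = LinearMap.id := by
    ext b
    have h : ∀ u : B ⊗[k] H, TensorProduct.rid k B
        (LinearMap.lTensor B (f ∘ₗ LinearMap.mul' k B ∘ₗ LinearMap.rTensor B s)
          (LinearMap.lTensor B Δ₁.toLinearMap u))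
        = TensorProduct.rid k B (LinearMap.lTensor B ε.toLinearMap u) := by
      intro u
      induction u using TensorProduct.induction_on with
      | zero => simp
      | add u₁ u₂ h₁ h₂ => simp only [map_add, h₁, h₂]
      | tmul b x => simp [hs, hf]
    simp [F, hco, h, hr]
  let g : B →ₗ[k] k := f ∘ₗ LinearMap.mulLeft k (s 1)
  have hF : ∀ b, F (1 ⊗ₜ b) = g b • 1 := by
    intro b
    simp [F, g, Algebra.TensorProduct.one_def]
  refine ⟨TensorProduct.lid k V (LinearMap.rTensor V g p), ?_⟩
  calc p = LinearMap.rTensor V (F ∘ₗ δl.toLinearMap) p := by simp [hFδ]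
    _ = LinearMap.rTensor V F ((TensorProduct.assoc k H B V).symm (1 ⊗ₜ p)) := by
        rw [← hp]
        simp [LinearMap.rTensor_comp_apply]
    _ = _ := by
        clear hp
        induction p using TensorProduct.induction_on with
        | zero => simp
        | add u₁ u₂ h₁ h₂ => simp only [map_add, tmul_add, h₁, h₂]
        | tmul b v => simp [hF, smul_tmul]

/-- The characterization of invariant elements for one component `B` of a Hopf group-coalgebra,
with coactions `δr`, `δl` of the neutral component `H`. -/
lemma left_invariant_iff (δr : B →ₐ[k] B ⊗[k] H) (δl : B →ₐ[k] H ⊗[k] B)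
    (Δ₁ : H →ₐ[k] C ⊗[k] B) (Δ₂ : H →ₐ[k] B ⊗[k] C) (ε : H →ₐ[k] k) (s : C →ₗ[k] B)
    (hco : ∀ b, TensorProduct.assoc k B C B (LinearMap.rTensor B Δ₂.toLinearMap (δl b))
      = LinearMap.lTensor B Δ₁.toLinearMap (δr b))
    (hco' : ∀ b, TensorProduct.assoc k H B H (LinearMap.rTensor H δl.toLinearMap (δr b))
      = LinearMap.lTensor H δr.toLinearMap (δl b))
    (hr : ∀ b, TensorProduct.rid k B (LinearMap.lTensor B ε.toLinearMap (δr b)) = b)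
    (hl : ∀ b, TensorProduct.lid k B (LinearMap.rTensor B ε.toLinearMap (δl b)) = b)
    (hs₁ : ∀ x, LinearMap.mul' k B (LinearMap.rTensor B s (Δ₁ x)) = ε x • 1)
    (hs₂ : ∀ x, LinearMap.mul' k B (LinearMap.lTensor B s (Δ₂ x)) = ε x • 1)
    (q : B ⊗[k] B) (hq : LinearMap.mul' k B q = 0) :
    (TensorProduct.map (LinearMap.mul' k H) LinearMap.id)
        ((TensorProduct.tensorTensorTensorComm k H B H B)
          (TensorProduct.map δl.toLinearMap δl.toLinearMap q)) = (1 : H) ⊗ₜ[k] q ↔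
      ∃ x : H, ε x = 0 ∧ LinearMap.rTensor H (LinearMap.mul' k B)
        ((TensorProduct.assoc k B B H).symm (LinearMap.lTensor B δr.toLinearMap q))
          = (1 : B) ⊗ₜ[k] x := by
  set r : B ⊗[k] B →ₗ[k] B ⊗[k] H := LinearMap.rTensor H (LinearMap.mul' k B) ∘ₗ
    (TensorProduct.assoc k B B H).symm.toLinearMap ∘ₗ LinearMap.lTensor B δr.toLinearMap with hrdef
  have hr_inj : Function.Injective r := mul_comul_injective δr δl Δ₁ Δ₂ ε s hco hl hs₂
  set Φ : B ⊗[k] B →ₗ[k] H ⊗[k] (B ⊗[k] B) :=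
    TensorProduct.map (LinearMap.mul' k H) LinearMap.id ∘ₗ
    (TensorProduct.tensorTensorTensorComm k H B H B).toLinearMap ∘ₗ
    TensorProduct.map δl.toLinearMap δl.toLinearMap with hΦ
  change Φ q = _ ↔ ∃ x : H, ε x = 0 ∧ r q = _
  have hr_tmul : ∀ a b, r (a ⊗ₜ b) = (a ⊗ₜ 1) * δr b := by
    intro a b
    have : ∀ u : B ⊗[k] H, LinearMap.rTensor H (LinearMap.mul' k B)
        ((TensorProduct.assoc k B B H).symm (a ⊗ₜ u)) = (a ⊗ₜ 1) * u := by
      intro u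
      induction u using TensorProduct.induction_on with
      | zero => simp
      | add u₁ u₂ h₁ h₂ => simp only [map_add, tmul_add, h₁, h₂, mul_add]
      | tmul b x => simp
    simp [hrdef, this]
  have hrΦ : ∀ p, LinearMap.lTensor H r (Φ p)
      = TensorProduct.assoc k H B H (LinearMap.rTensor H δl.toLinearMap (r p)) := by
    intro p
    induction p using TensorProduct.induction_on with
    | zero => simp
    | add p₁ p₂ h₁ h₂ => simp only [map_add, h₁, h₂]
    | tmul a b =>
      have h₁ : ∀ u v : H ⊗[k] B, LinearMap.lTensor H r
          (TensorProduct.map (LinearMap.mul' k H) LinearMap.id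
            (TensorProduct.tensorTensorTensorComm k H B H B (u ⊗ₜ v)))
          = TensorProduct.assoc k H B H (u ⊗ₜ 1) * LinearMap.lTensor H δr.toLinearMap v := by
        intro u v
        induction u using TensorProduct.induction_on with
        | zero => simp
        | add u₁ u₂ h₁ h₂ => simp only [map_add, add_tmul, h₁, h₂, add_mul]
        | tmul x a =>
          induction v using TensorProduct.induction_on with
          | zero => simp
          | add v₁ v₂ h₁ h₂ => simp only [map_add, tmul_add, h₁, h₂, mul_add]
          | tmul y b => simp [hr_tmul]
      have h₂ : ∀ u : B ⊗[k] H, TensorProduct.assoc k H B H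
          (LinearMap.rTensor H δl.toLinearMap ((a ⊗ₜ 1) * u))
          = TensorProduct.assoc k H B H (δl a ⊗ₜ 1) *
            TensorProduct.assoc k H B H (LinearMap.rTensor H δl.toLinearMap u) := by
        intro u
        have hmul : ∀ v w : (H ⊗[k] B) ⊗[k] H, TensorProduct.assoc k H B H (v * w)
            = TensorProduct.assoc k H B H v * TensorProduct.assoc k H B H w :=
          map_mul (Algebra.TensorProduct.assoc k k k H B H)
        rw [← hmul]
        congr 1
        induction u using TensorProduct.induction_on with
        | zero => simp
        | add u₁ u₂ h₁ h₂ => simp only [map_add, h₁, h₂, mul_add]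
        | tmul b x => simp
      rw [hr_tmul, h₂, hco', ← h₁]
      simp [hΦ]
  have hεr : ∀ p, TensorProduct.rid k B (LinearMap.lTensor B ε.toLinearMap (r p))
      = LinearMap.mul' k B p := by
    intro p
    induction p using TensorProduct.induction_on with
    | zero => simp
    | add p₁ p₂ h₁ h₂ => simp only [map_add, h₁, h₂]
    | tmul a b =>
      have : ∀ u : B ⊗[k] H,
          TensorProduct.rid k B (LinearMap.lTensor B ε.toLinearMap ((a ⊗ₜ 1) * u))
          = a * TensorProduct.rid k B (LinearMap.lTensor B ε.toLinearMap u) := by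
        intro u
        induction u using TensorProduct.induction_on with
        | zero => simp
        | add u₁ u₂ h₁ h₂ => simp only [map_add, h₁, h₂, mul_add]
        | tmul b x => simp
      rw [hr_tmul, this, hr, LinearMap.mul'_apply]
  constructor
  · intro h
    rcases subsingleton_or_nontrivial B with hB | hB
    · exact ⟨0, map_zero ε, by simp [Subsingleton.elim q 0]⟩
    · obtain ⟨x, hx⟩ := exists_eq_one_tmul_of_coinvariant δr δl Δ₁ Δ₂ ε s hco hr hs₁ (r q)
        (by rw [← hrΦ, h, LinearMap.lTensor_tmul])
      refine ⟨x, ?_, hx⟩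
      have := hεr q
      rw [hx, hq] at this
      simpa using this
  · rintro ⟨x, -, hx⟩
    apply Module.Flat.lTensor_preserves_injective_linearMap (M := H) r hr_inj
    rw [hrΦ, LinearMap.lTensor_tmul, hx]
    simp [Algebra.TensorProduct.one_def]

/-- Coassociativity is preserved by flipping all comultiplications. -/
lemma coassoc_flip {X Y Z P Q : Type} [Ring X] [Algebra k X] [Ring Y] [Algebra k Y]
    [Ring Z] [Algebra k Z] [Ring P] [Algebra k P] [Ring Q] [Algebra k Q]
    (f : P →ₐ[k] X ⊗[k] Y) (g : Q →ₐ[k] Y ⊗[k] Z) (u : P ⊗[k] Z) (v : X ⊗[k] Q)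
    (h : TensorProduct.assoc k X Y Z (LinearMap.rTensor Z f.toLinearMap u)
      = LinearMap.lTensor X g.toLinearMap v) :
    TensorProduct.assoc k Z Y X (LinearMap.rTensor X
        ((Algebra.TensorProduct.comm k Y Z).toAlgHom.comp g).toLinearMap
        (TensorProduct.comm k X Q v))
      = LinearMap.lTensor Z ((Algebra.TensorProduct.comm k X Y).toAlgHom.comp f).toLinearMap
        (TensorProduct.comm k P Z u) := by
  let σ : X ⊗[k] (Y ⊗[k] Z) →ₗ[k] Z ⊗[k] (Y ⊗[k] X) :=
    (TensorProduct.assoc k Z Y X).toLinearMap ∘ₗ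
      (TensorProduct.comm k X (Z ⊗[k] Y)).toLinearMap ∘ₗ
      LinearMap.lTensor X (TensorProduct.comm k Y Z).toLinearMap
  trans σ (LinearMap.lTensor X g.toLinearMap v)
  · clear h
    induction v using TensorProduct.induction_on with
    | zero => simp
    | add v₁ v₂ h₁ h₂ => simp only [map_add, h₁, h₂]
    | tmul x b =>
      simp only [LinearMap.comp_apply, LinearEquiv.coe_coe, LinearMap.lTensor_tmul,
        LinearMap.rTensor_tmul, TensorProduct.comm_tmul, σ]
      rfl
  · rw [← h]
    clear h
    induction u using TensorProduct.induction_on with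
    | zero => simp
    | add v₁ v₂ h₁ h₂ => simp only [map_add, h₁, h₂]
    | tmul p z =>
      have h : ∀ w : X ⊗[k] Y, σ (TensorProduct.assoc k X Y Z (w ⊗ₜ z))
          = z ⊗ₜ TensorProduct.comm k X Y w := by
        intro w
        induction w using TensorProduct.induction_on with
        | zero => simp
        | add v₁ v₂ h₁ h₂ => simp only [map_add, add_tmul, tmul_add, h₁, h₂]
        | tmul x y => simp [σ]
      simp only [LinearMap.rTensor_tmul, AlgHom.toLinearMap_apply, h]
      rfl

/-- The right-handed version of `left_invariant_iff`. -/
lemma right_invariant_iff (δr : B →ₐ[k] B ⊗[k] H) (δl : B →ₐ[k] H ⊗[k] B)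
    (Δ₁ : H →ₐ[k] C ⊗[k] B) (Δ₂ : H →ₐ[k] B ⊗[k] C) (ε : H →ₐ[k] k) (s : C →ₗ[k] B)
    (hco : ∀ b, TensorProduct.assoc k B C B (LinearMap.rTensor B Δ₂.toLinearMap (δl b))
      = LinearMap.lTensor B Δ₁.toLinearMap (δr b))
    (hco' : ∀ b, TensorProduct.assoc k H B H (LinearMap.rTensor H δl.toLinearMap (δr b))
      = LinearMap.lTensor H δr.toLinearMap (δl b))
    (hr : ∀ b, TensorProduct.rid k B (LinearMap.lTensor B ε.toLinearMap (δr b)) = b)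
    (hl : ∀ b, TensorProduct.lid k B (LinearMap.rTensor B ε.toLinearMap (δl b)) = b)
    (hs₁ : ∀ x, LinearMap.mul' k B (TensorProduct.comm k B B (LinearMap.rTensor B s (Δ₁ x)))
      = ε x • 1)
    (hs₂ : ∀ x, LinearMap.mul' k B (TensorProduct.comm k B B (LinearMap.lTensor B s (Δ₂ x)))
      = ε x • 1)
    (q : B ⊗[k] B) (hq : LinearMap.mul' k B q = 0) :
    (TensorProduct.map LinearMap.id (LinearMap.mul' k H))
        ((TensorProduct.tensorTensorTensorComm k B H B H)
          (TensorProduct.map δr.toLinearMap δr.toLinearMap q)) = q ⊗ₜ[k] (1 : H) ↔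
      ∃ y : H, ε y = 0 ∧ LinearMap.lTensor H (LinearMap.mul' k B)
        ((TensorProduct.leftComm k B H B) (LinearMap.lTensor B δl.toLinearMap q))
          = y ⊗ₜ[k] (1 : B) := by
  have key := left_invariant_iff
    ((Algebra.TensorProduct.comm k H B).toAlgHom.comp δl)
    ((Algebra.TensorProduct.comm k B H).toAlgHom.comp δr)
    ((Algebra.TensorProduct.comm k B C).toAlgHom.comp Δ₂)
    ((Algebra.TensorProduct.comm k C B).toAlgHom.comp Δ₁) ε s
    (fun b => coassoc_flip _ _ _ _ (hco b)) (fun b => coassoc_flip _ _ _ _ (hco' b))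
    (fun b => by
      refine Eq.trans ?_ (hl b)
      change TensorProduct.rid k B (LinearMap.lTensor B ε.toLinearMap
        (TensorProduct.comm k H B (δl b))) = _
      induction δl b using TensorProduct.induction_on with
      | zero => simp
      | add v₁ v₂ h₁ h₂ => simp only [map_add, h₁, h₂]
      | tmul x y => simp)
    (fun b => by
      refine Eq.trans ?_ (hr b)
      change TensorProduct.lid k B (LinearMap.rTensor B ε.toLinearMap
        (TensorProduct.comm k B H (δr b))) = _
      induction δr b using TensorProduct.induction_on with
      | zero => simp
      | add v₁ v₂ h₁ h₂ => simp only [map_add, h₁, h₂]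
      | tmul x y => simp)
    (fun x => by
      rw [← hs₂]
      change LinearMap.mul' k B (LinearMap.rTensor B s (TensorProduct.comm k B C (Δ₂ x))) = _
      induction Δ₂ x using TensorProduct.induction_on with
      | zero => simp
      | add v₁ v₂ h₁ h₂ => simp only [map_add, h₁, h₂]
      | tmul x y => simp)
    (fun x => by
      rw [← hs₁]
      change LinearMap.mul' k B (LinearMap.lTensor B s (TensorProduct.comm k C B (Δ₁ x))) = _
      induction Δ₁ x using TensorProduct.induction_on with
      | zero => simp
      | add v₁ v₂ h₁ h₂ => simp only [map_add, h₁, h₂]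
      | tmul x y => simp)
    q hq
  refine Iff.trans ?_ (key.trans (exists_congr fun x => and_congr_right fun _ => ?_))
  · rw [← (TensorProduct.comm k (B ⊗[k] B) H).injective.eq_iff, TensorProduct.comm_tmul]
    refine Eq.congr_left ?_
    clear hq key
    induction q using TensorProduct.induction_on with
    | zero => simp
    | add v₁ v₂ h₁ h₂ => simp only [map_add, h₁, h₂]
    | tmul a b =>
      have h : ∀ u v : B ⊗[k] H, TensorProduct.comm k (B ⊗[k] B) H
          (TensorProduct.map LinearMap.id (LinearMap.mul' k H)
            (TensorProduct.tensorTensorTensorComm k B H B H (u ⊗ₜ v)))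
          = TensorProduct.map (LinearMap.mul' k H) LinearMap.id
            (TensorProduct.tensorTensorTensorComm k H B H B
              (TensorProduct.comm k B H u ⊗ₜ TensorProduct.comm k B H v)) := by
        intro u v
        induction u using TensorProduct.induction_on with
        | zero => simp
        | add u₁ u₂ h₁ h₂ => simp only [map_add, add_tmul, h₁, h₂]
        | tmul a x =>
          induction v using TensorProduct.induction_on with
          | zero => simp
          | add v₁ v₂ h₁ h₂ => simp only [map_add, tmul_add, h₁, h₂]
          | tmul b y => simp
      simp only [TensorProduct.map_tmul]
      exact h _ _
  · rw [← (TensorProduct.comm k H B).injective.eq_iff (b := x ⊗ₜ[k] (1 : B)),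
      TensorProduct.comm_tmul]
    refine Eq.congr_left ?_
    clear hq key
    induction q using TensorProduct.induction_on with
    | zero => simp
    | add v₁ v₂ h₁ h₂ => simp only [map_add, h₁, h₂]
    | tmul a b =>
      have h : ∀ u : H ⊗[k] B, LinearMap.rTensor H (LinearMap.mul' k B)
          ((TensorProduct.assoc k B B H).symm (a ⊗ₜ TensorProduct.comm k H B u))
          = TensorProduct.comm k H B (LinearMap.lTensor H (LinearMap.mul' k B)
            (TensorProduct.leftComm k B H B (a ⊗ₜ u))) := by
        intro u
        induction u using TensorProduct.induction_on with
        | zero => simp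
        | add u₁ u₂ h₁ h₂ => simp only [map_add, tmul_add, h₁, h₂]
        | tmul x b => simp
      simp only [LinearMap.lTensor_tmul]
      exact h _

/-- The inverse of an antipode satisfies the antipode identities for the flipped
comultiplications. -/
lemma mul_comm_inverse_antipode (S : B ≃ₗ[k] C) (hmul : ∀ a b, S (a * b) = S b * S a)
    (hone : S 1 = 1) (u : C ⊗[k] B) (e : k)
    (h : LinearMap.mul' k C (LinearMap.lTensor C S.toLinearMap u) = e • 1) :
    LinearMap.mul' k B (TensorProduct.comm k B B
      (LinearMap.rTensor B S.symm.toLinearMap u)) = e • 1 := by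
  apply S.injective
  rw [map_smul, hone, ← h]
  clear h
  induction u using TensorProduct.induction_on with
  | zero => simp
  | add u₁ u₂ h₁ h₂ => simp only [map_add, h₁, h₂]
  | tmul x b => simp [hmul]

lemma mul_comm_inverse_antipode' (S : B ≃ₗ[k] C) (hmul : ∀ a b, S (a * b) = S b * S a)
    (hone : S 1 = 1) (u : B ⊗[k] C) (e : k)
    (h : LinearMap.mul' k C (LinearMap.rTensor C S.toLinearMap u) = e • 1) :
    LinearMap.mul' k B (TensorProduct.comm k B B
      (LinearMap.lTensor B S.symm.toLinearMap u)) = e • 1 := by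
  apply S.injective
  rw [map_smul, hone, ← h]
  clear h
  induction u using TensorProduct.induction_on with
  | zero => simp
  | add u₁ u₂ h₁ h₂ => simp only [map_add, h₁, h₂]
  | tmul b x => simp [hmul]

end Auxiliary

/-- Assume the antipodes are bijective. An element `q ∈ A_α²` is left
invariant (`Φˡ_{1,α}(q) = 1 ⊗ q`) iff `q = r_α⁻¹(1_α ⊗ x)` for some `x ∈ ker ε`
(equivalently `r_α(q) = 1_α ⊗ x`), and right invariant (`Φʳ_{α,1}(q) = q ⊗ 1`) iff
`q = t_α⁻¹(y ⊗ 1_α)` for some `y ∈ ker ε` (equivalently `t_α(q) = y ⊗ 1_α`). -/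
theorem invariant_elements_of_A2
    {k : Type} [Field k] {G : Type} [Group G]
    (A : G → Type) [∀ α, Ring (A α)] [∀ α, Algebra k (A α)]
    (Δ : ∀ α β γ : G, α * β = γ → (A γ →ₐ[k] A α ⊗[k] A β))
    (ε : A 1 →ₐ[k] k)
    (S : ∀ α β : G, α⁻¹ = β → (A α →ₗ[k] A β))
    (hcoassoc : ∀ (α β γ : G) (x : A (α * β * γ)),
      (TensorProduct.assoc k (A α) (A β) (A γ))
          ((Algebra.TensorProduct.map (Δ α β (α * β) rfl) (AlgHom.id k (A γ)))
            ((Δ (α * β) γ (α * β * γ) rfl) x))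
        = (Algebra.TensorProduct.map (AlgHom.id k (A α)) (Δ β γ (β * γ) rfl))
            ((Δ α (β * γ) (α * β * γ) (mul_assoc α β γ).symm) x))
    (hcounit₁ : ∀ (α : G) (x : A α),
      (TensorProduct.rid k (A α)) ((LinearMap.lTensor (A α) ε.toLinearMap)
        ((Δ α 1 α (mul_one α)) x)) = x)
    (hcounit₂ : ∀ (α : G) (x : A α),
      (TensorProduct.lid k (A α)) ((LinearMap.rTensor (A α) ε.toLinearMap)
        ((Δ 1 α α (one_mul α)) x)) = x)
    (hantipode₁ : ∀ (α : G) (x : A 1),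
      (LinearMap.mul' k (A α)) ((LinearMap.rTensor (A α) (S α⁻¹ α (inv_inv α)))
        ((Δ α⁻¹ α 1 (inv_mul_cancel α)) x)) = ε x • 1)
    (hantipode₂ : ∀ (α : G) (x : A 1),
      (LinearMap.mul' k (A α)) ((LinearMap.lTensor (A α) (S α⁻¹ α (inv_inv α)))
        ((Δ α α⁻¹ 1 (mul_inv_cancel α)) x)) = ε x • 1)
    (hS : ∀ α : G, Function.Bijective (S α α⁻¹ rfl)) :
    ∀ (α : G) (q : A α ⊗[k] A α), q ∈ A2sub k (A α) →
      ((PhiL A Δ 1 α α (one_mul α) q = (1 : A 1) ⊗ₜ[k] q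
          ↔ ∃ x : A 1, ε x = 0 ∧ rmap A Δ α q = (1 : A α) ⊗ₜ[k] x)
        ∧ (PhiR A Δ α 1 α (mul_one α) q = q ⊗ₜ[k] (1 : A 1)
          ↔ ∃ y : A 1, ε y = 0 ∧ tmap A Δ α q = y ⊗ₜ[k] (1 : A α))) := by
  have hco : ∀ (α β γ δ ζ η : G) (h₁ : α * β = δ) (h₂ : δ * γ = η) (h₃ : β * γ = ζ)
      (h₄ : α * ζ = η) (x : A η),
      TensorProduct.assoc k (A α) (A β) (A γ)
          (LinearMap.rTensor (A γ) (Δ α β δ h₁).toLinearMap (Δ δ γ η h₂ x))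
        = LinearMap.lTensor (A α) (Δ β γ ζ h₃).toLinearMap (Δ α ζ η h₄ x) := by
    intro α β γ δ ζ η h₁ h₂ h₃ h₄ x
    subst h₁ h₂ h₃
    exact hcoassoc α β γ x
  have hant₁ : ∀ (α β : G) (h : β⁻¹ = α) (h' : β * α = 1) (x : A 1),
      LinearMap.mul' k (A α) (LinearMap.rTensor (A α) (S β α h) (Δ β α 1 h' x)) = ε x • 1 := by
    intro α β h h' x
    obtain rfl : β = α⁻¹ := by rw [← h, inv_inv]
    exact hantipode₁ α x
  have hant₂ : ∀ (α β : G) (h : β⁻¹ = α) (h' : α * β = 1) (x : A 1),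
      LinearMap.mul' k (A α) (LinearMap.lTensor (A α) (S β α h) (Δ α β 1 h' x)) = ε x • 1 := by
    intro α β h h' x
    obtain rfl : β = α⁻¹ := by rw [← h, inv_inv]
    exact hantipode₂ α x
  intro α q hq
  let T : A α ≃ₗ[k] A α⁻¹ := LinearEquiv.ofBijective (S α α⁻¹ rfl) (hS α)
  have hco_α := hco α α⁻¹ α 1 1 α (mul_inv_cancel α) (one_mul α) (inv_mul_cancel α) (mul_one α)
  have hco_one := hco 1 α 1 α α α (one_mul α) (mul_one α) (mul_one α) (one_mul α)
  have hT₁ := hant₁ α⁻¹ α rfl (mul_inv_cancel α)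
  have hT₂ := hant₂ α⁻¹ α rfl (inv_mul_cancel α)
  have hT_mul : ∀ a b, T (a * b) = T b * T a :=
    antipode_map_mul _ _ _ _ ε T.toLinearMap hco_α (hcounit₁ α) (hcounit₂ α) hT₂ hT₁
  have hT_one : T 1 = 1 := by
    have := hT₂ 1
    rw [map_one (Δ α⁻¹ α 1 _), map_one ε, Algebra.TensorProduct.one_def, LinearMap.lTensor_tmul,
      LinearMap.mul'_apply, one_mul, one_smul] at this
    exact this
  exact ⟨left_invariant_iff _ _ _ _ ε (S α⁻¹ α (inv_inv α)) hco_α hco_one (hcounit₁ α)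
      (hcounit₂ α) (hantipode₁ α) (hantipode₂ α) q hq,
    right_invariant_iff _ _ _ _ ε T.symm.toLinearMap hco_α hco_one (hcounit₁ α) (hcounit₂ α)
      (fun x => mul_comm_inverse_antipode T hT_mul hT_one _ _ (hT₂ x))
      (fun x => mul_comm_inverse_antipode' T hT_mul hT_one _ _ (hT₁ x)) q hq⟩
end

section
/- Assume each antipode S_α is bijective. Let R be a right ideal of A₁ with R ⊆ ker ε, and for each α ∈ π set N_α = t_α⁻¹(R ⊗ A_α). Then each N_α is an A_α-sub-bimodule of A_α², and the π-graded first order differential calculus (Γ, d) with Γ_α = A_α²/N_α, canonical quotient map π_α, and d_α = π_α ∘ D_α, is right covariant. Conversely, every right covariant π-graded first order differential calculus over A is isomorphic to one obtained in this way from such a right ideal R of A₁ contained in ker ε. -/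
open TensorProduct

/-- The componentwise action of `R ⊗[k] S` on `M ⊗[k] N` induced by `k`-bilinear
actions `f` of `R` on `M` and `g` of `S` on `N`: `(r ⊗ s) • (m ⊗ n) = (f r m) ⊗ (g s n)`. -/
noncomputable def tact {k : Type} [Field k] {R S M N : Type}
    [AddCommGroup R] [Module k R] [AddCommGroup S] [Module k S]
    [AddCommGroup M] [Module k M] [AddCommGroup N] [Module k N]
    (f : R →ₗ[k] M →ₗ[k] M) (g : S →ₗ[k] N →ₗ[k] N) :
    R ⊗[k] S →ₗ[k] (M ⊗[k] N) →ₗ[k] M ⊗[k] N :=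
  TensorProduct.lift (LinearMap.mk₂ k (fun r s => TensorProduct.map (f r) (g s))
    (fun r r' s => by simp only [map_add, TensorProduct.map_add_left])
    (fun c r s => by simp only [map_smul, TensorProduct.map_smul_left])
    (fun r s s' => by simp only [map_add, TensorProduct.map_add_right])
    (fun r c s => by simp only [map_smul, TensorProduct.map_smul_right]))

/-- Descend a bilinear action `act` of `R` on `M` to the quotient `p ⧸ (N ∩ p)` of an
action-stable submodule `p ⊆ M` by an action-stable submodule `N`. -/
noncomputable def descend {k M R : Type} [Field k] [AddCommGroup M] [Module k M]
    [AddCommGroup R] [Module k R]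
    (p N : Submodule k M) (act : R →ₗ[k] M →ₗ[k] M)
    (hp : ∀ (c : R), ∀ x ∈ p, act c x ∈ p)
    (hN : ∀ (c : R), ∀ x ∈ N, act c x ∈ N) :
    R →ₗ[k] (p ⧸ N.comap p.subtype) →ₗ[k] (p ⧸ N.comap p.subtype) where
  toFun c := Submodule.mapQ _ _ ((act c).restrict (hp c))
    (fun x hx => by
      simp only [Submodule.mem_comap, LinearMap.restrict_apply] at hx ⊢
      exact hN c _ hx)
  map_add' c c' := by
    apply Submodule.linearMap_qext
    ext x
    simp only [LinearMap.comp_apply, Submodule.mkQ_apply, Submodule.mapQ_apply,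
      LinearMap.add_apply]
    rw [← Submodule.Quotient.mk_add]
    congr 1
    ext
    simp [LinearMap.restrict_apply, map_add]
  map_smul' t c := by
    apply Submodule.linearMap_qext
    ext x
    simp only [LinearMap.comp_apply, Submodule.mkQ_apply, Submodule.mapQ_apply,
      RingHom.id_apply, LinearMap.smul_apply]
    rw [← Submodule.Quotient.mk_smul]
    congr 1
    ext
    simp [LinearMap.restrict_apply, map_smul]

/-- The differential `d = π ∘ D : R → A²/N` of the quotient first order
differential calculus. -/
noncomputable def dQ (k R : Type) [Field k] [Ring R] [Algebra k R]
    (N : Submodule k (R ⊗[k] R)) :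
    R →ₗ[k] ((A2sub k R) ⧸ N.comap (A2sub k R).subtype) :=
  (N.comap (A2sub k R).subtype).mkQ ∘ₗ
    (LinearMap.codRestrict (A2sub k R) (Dmap k R) (Dmap_mem_A2sub k R))

/-- The left action of `R` on the quotient `A²/N`. -/
noncomputable def lactQ (k R : Type) [Field k] [Ring R] [Algebra k R]
    (N : Submodule k (R ⊗[k] R))
    (hL : ∀ (c : R), ∀ x ∈ N, lmulTb k R c x ∈ N) :
    R →ₗ[k] (A2sub k R ⧸ N.comap (A2sub k R).subtype) →ₗ[k]
      (A2sub k R ⧸ N.comap (A2sub k R).subtype) :=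
  descend (A2sub k R) N (lmulTb k R) (lmulTb_mem_A2sub k R) hL

/-- The right action of `R` on the quotient `A²/N`. -/
noncomputable def ractQ (k R : Type) [Field k] [Ring R] [Algebra k R]
    (N : Submodule k (R ⊗[k] R))
    (hR : ∀ (c : R), ∀ x ∈ N, rmulTb k R c x ∈ N) :
    R →ₗ[k] (A2sub k R ⧸ N.comap (A2sub k R).subtype) →ₗ[k]
      (A2sub k R ⧸ N.comap (A2sub k R).subtype) :=
  descend (A2sub k R) N (rmulTb k R) (rmulTb_mem_A2sub k R) hR

/-- `N_α = t_α⁻¹(R ⊗ A_α)` for a right ideal `R ⊆ A₁`. -/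
noncomputable def NofT {k : Type} [Field k] {G : Type} [Group G]
    (A : G → Type) [∀ α, Ring (A α)] [∀ α, Algebra k (A α)]
    (Δ : ∀ α β γ : G, α * β = γ → (A γ →ₐ[k] A α ⊗[k] A β))
    (Rid : Submodule k (A 1)) (α : G) : Submodule k (A α ⊗[k] A α) :=
  Submodule.comap (tmap A Δ α) (LinearMap.range (LinearMap.rTensor (A α) Rid.subtype))

section Coaction

variable {k : Type} [Field k]

/-- The map `a ⊗ b ↦ a · d b` attached to a left action `sl` and a map `d`. -/
noncomputable def fodcMap {X Γ : Type} [AddCommGroup X] [Module k X] [AddCommGroup Γ] [Module k Γ]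
    (sl : X →ₗ[k] Γ →ₗ[k] Γ) (d : X →ₗ[k] Γ) : X ⊗[k] X →ₗ[k] Γ :=
  TensorProduct.lift (sl.compl₂ d)

@[simp] lemma fodcMap_tmul {X Γ : Type} [AddCommGroup X] [Module k X] [AddCommGroup Γ] [Module k Γ]
    (sl : X →ₗ[k] Γ →ₗ[k] Γ) (d : X →ₗ[k] Γ) (a b : X) :
    fodcMap sl d (a ⊗ₜ b) = sl a (d b) := rfl

/-- `(p ⊗ q) ⊗ (x ⊗ y) ↦ (p ⊗ x) ⊗ q y`. -/
noncomputable def mulSnd (k X Y : Type) [Field k] [Ring X] [Algebra k X] [Ring Y] [Algebra k Y] :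
    (X ⊗[k] Y) ⊗[k] (X ⊗[k] Y) →ₗ[k] (X ⊗[k] X) ⊗[k] Y :=
  LinearMap.lTensor _ (LinearMap.mul' k Y) ∘ₗ
    (TensorProduct.tensorTensorTensorComm k X Y X Y).toLinearMap

/-- The diagonal coaction `a ⊗ b ↦ a₁ ⊗ b₁ ⊗ a₂ b₂`. -/
noncomputable def diagCoact {X Y Z : Type} [Ring X] [Algebra k X] [Ring Y] [Algebra k Y]
    [Ring Z] [Algebra k Z] (Δ : Z →ₐ[k] X ⊗[k] Y) : Z ⊗[k] Z →ₗ[k] (X ⊗[k] X) ⊗[k] Y :=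
  mulSnd k X Y ∘ₗ TensorProduct.map Δ.toLinearMap Δ.toLinearMap

/-- `a ⊗ b ↦ b₁ ⊗ a b₂`. -/
noncomputable def galoisMap {X E : Type} [Ring X] [Algebra k X] [Ring E] [Algebra k E]
    (δ : X →ₐ[k] E ⊗[k] X) : X ⊗[k] X →ₗ[k] E ⊗[k] X :=
  (LinearMap.lTensor E (LinearMap.mul' k X)) ∘ₗ
    (TensorProduct.leftComm k X E X).toLinearMap ∘ₗ (LinearMap.lTensor X δ.toLinearMap)

/-- The projection `a ⊗ b ↦ a ⊗ b - a b ⊗ 1` of `X ⊗ X` onto the kernel of multiplication. -/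
noncomputable def projA2 (k X : Type) [Field k] [Ring X] [Algebra k X] :
    X ⊗[k] X →ₗ[k] X ⊗[k] X :=
  LinearMap.id - (TensorProduct.mk k X X).flip 1 ∘ₗ LinearMap.mul' k X

variable {X Y Z E B Γ : Type} [Ring X] [Algebra k X] [Ring Y] [Algebra k Y]
  [Ring Z] [Algebra k Z] [Ring E] [Algebra k E] [Ring B] [Algebra k B]
  [AddCommGroup Γ] [Module k Γ]

@[simp] lemma mulSnd_tmul (p x : X) (q y : Y) :
    mulSnd k X Y ((p ⊗ₜ q) ⊗ₜ (x ⊗ₜ y)) = (p ⊗ₜ x) ⊗ₜ (q * y) := by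
  simp [mulSnd]

lemma diagCoact_tmul (Δ : Z →ₐ[k] X ⊗[k] Y) (a b : Z) :
    diagCoact Δ (a ⊗ₜ b) = mulSnd k X Y (Δ a ⊗ₜ Δ b) := rfl

lemma galoisMap_tmul (δ : X →ₐ[k] E ⊗[k] X) (a b : X) :
    galoisMap δ (a ⊗ₜ b) = LinearMap.lTensor E (LinearMap.mulLeft k a) (δ b) := by
  simp only [galoisMap, LinearMap.comp_apply, LinearMap.lTensor_tmul, AlgHom.toLinearMap_apply]
  induction δ b with
  | zero => simp
  | tmul x y => simp
  | add x y hx hy => simp only [TensorProduct.tmul_add, map_add, hx, hy]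

lemma lTensor_mulLeft_eq (a : X) (u : E ⊗[k] X) :
    LinearMap.lTensor E (LinearMap.mulLeft k a) u = ((1 : E) ⊗ₜ[k] a) * u := by
  induction u with
  | zero => simp
  | tmul x y => simp
  | add x y hx hy => simp only [map_add, mul_add, hx, hy]

@[simp] lemma projA2_tmul (a b : X) :
    projA2 k X (a ⊗ₜ b) = a ⊗ₜ b - (a * b) ⊗ₜ 1 := rfl

lemma projA2_of_mem {x : X ⊗[k] X} (hx : x ∈ A2sub k X) : projA2 k X x = x := by
  have h : LinearMap.mul' k X x = 0 := hx
  simp [projA2, h]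

lemma projA2_mem (x : X ⊗[k] X) : projA2 k X x ∈ A2sub k X := by
  simp [projA2, A2sub]

lemma tact_rTensor (sl : X →ₗ[k] Γ →ₗ[k] Γ) (d : X →ₗ[k] Γ) (u v : X ⊗[k] Y) :
    tact sl (LinearMap.mul k Y) u (LinearMap.rTensor Y d v)
      = LinearMap.rTensor Y (fodcMap sl d) (mulSnd k X Y (u ⊗ₜ v)) := by
  induction u with
  | zero => simp
  | add x y hx hy => simp only [map_add, LinearMap.add_apply, TensorProduct.add_tmul, hx, hy]
  | tmul p q =>
    induction v with
    | zero => simp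
    | add x y hx hy => simp only [map_add, TensorProduct.tmul_add, hx, hy]
    | tmul x y => simp [tact]

lemma sum_tact (sl : X →ₗ[k] Γ →ₗ[k] Γ) (d : X →ₗ[k] Γ) (Δ : Z →ₐ[k] X ⊗[k] Y)
    {n : ℕ} (a b : Fin n → Z) :
    ∑ i, tact sl (LinearMap.mul k Y) (Δ (a i)) (LinearMap.rTensor Y d (Δ (b i)))
      = LinearMap.rTensor Y (fodcMap sl d) (diagCoact Δ (∑ i, a i ⊗ₜ b i)) := by
  simp only [map_sum, diagCoact_tmul, tact_rTensor]

lemma fodcMap_sum (sl : X →ₗ[k] Γ →ₗ[k] Γ) (d : X →ₗ[k] Γ) {n : ℕ} (a b : Fin n → X) :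
    fodcMap sl d (∑ i, a i ⊗ₜ b i) = ∑ i, sl (a i) (d (b i)) := by
  simp only [map_sum, fodcMap_tmul]

lemma rTensor_eq_zero_of_ker_le {M M' M'' : Type} [AddCommGroup M] [Module k M]
    [AddCommGroup M'] [Module k M'] [AddCommGroup M''] [Module k M'']
    (g : M →ₗ[k] M') (f : M →ₗ[k] M'') (h : LinearMap.ker g ≤ LinearMap.ker f)
    (z : M ⊗[k] Y) (hz : LinearMap.rTensor Y g z = 0) : LinearMap.rTensor Y f z = 0 := by
  have hex := Module.Flat.rTensor_exact Y (LinearMap.exact_subtype_ker_map g)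
  obtain ⟨w, rfl⟩ := (hex z).1 hz
  rw [← LinearMap.comp_apply, ← LinearMap.rTensor_comp]
  have : f ∘ₗ (LinearMap.ker g).subtype = 0 := by
    ext x
    exact h x.2
  simp [this]

lemma mem_range_rTensor_subtype_iff {M : Type} [AddCommGroup M] [Module k M]
    (R : Submodule k M) (z : M ⊗[k] Y) :
    z ∈ LinearMap.range (LinearMap.rTensor Y R.subtype) ↔ LinearMap.rTensor Y R.mkQ z = 0 :=
  (rTensor_exact Y (LinearMap.exact_subtype_mkQ R) R.mkQ_surjective z).symm

lemma galoisMap_lmulTb (δ : X →ₐ[k] E ⊗[k] X) (c : X) (x : X ⊗[k] X) :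
    galoisMap δ (lmulTb k X c x) = LinearMap.lTensor E (LinearMap.mulLeft k c) (galoisMap δ x) := by
  induction x with
  | zero => simp
  | add x y hx hy => simp only [map_add, hx, hy]
  | tmul a b =>
    simp only [lmulTb, LinearMap.comp_apply, LinearMap.coe_rTensorHom, LinearMap.rTensor_tmul,
      LinearMap.mul_apply', galoisMap_tmul, LinearMap.mulLeft_mul, LinearMap.lTensor_comp]

lemma galoisMap_rmulTb (δ : X →ₐ[k] E ⊗[k] X) (c : X) (x : X ⊗[k] X) :
    galoisMap δ (rmulTb k X c x) = galoisMap δ x * δ c := by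
  induction x with
  | zero => simp
  | add x y hx hy => simp only [map_add, add_mul, hx, hy]
  | tmul a b =>
    simp [rmulTb, galoisMap_tmul, lTensor_mulLeft_eq, mul_assoc]

lemma lid_rTensor_galoisMap (δ : X →ₐ[k] E ⊗[k] X) (ε : E →ₐ[k] k)
    (hε : ∀ x, TensorProduct.lid k X (LinearMap.rTensor X ε.toLinearMap (δ x)) = x)
    (x : X ⊗[k] X) :
    TensorProduct.lid k X (LinearMap.rTensor X ε.toLinearMap (galoisMap δ x))
      = LinearMap.mul' k X x := by
  induction x with
  | zero => simp
  | add x y hx hy => simp only [map_add, hx, hy]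
  | tmul a b =>
    have key : ∀ u : E ⊗[k] X, TensorProduct.lid k X (LinearMap.rTensor X ε.toLinearMap
        (LinearMap.lTensor E (LinearMap.mulLeft k a) u))
        = a * TensorProduct.lid k X (LinearMap.rTensor X ε.toLinearMap u) := by
      intro u
      induction u with
      | zero => simp
      | add x y hx hy => simp only [map_add, mul_add, hx, hy]
      | tmul x y => simp
    rw [galoisMap_tmul, key, hε, LinearMap.mul'_apply]

/-- Compatibility of the Galois maps with the comultiplication. -/
lemma assoc_rTensor_galoisMap (δX : X →ₐ[k] E ⊗[k] X) (δZ : Z →ₐ[k] E ⊗[k] Z)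
    (Δ : Z →ₐ[k] X ⊗[k] Y)
    (hco : ∀ z, TensorProduct.assoc k E X Y (LinearMap.rTensor Y δX.toLinearMap (Δ z))
      = LinearMap.lTensor E Δ.toLinearMap (δZ z)) (x : Z ⊗[k] Z) :
    TensorProduct.assoc k E X Y (LinearMap.rTensor Y (galoisMap δX) (diagCoact Δ x))
      = LinearMap.lTensor E Δ.toLinearMap (galoisMap δZ x) := by
  induction x with
  | zero => simp
  | add x y hx hy => simp only [map_add, hx, hy]
  | tmul a b =>
    have h1 : ∀ u v : X ⊗[k] Y,
        TensorProduct.assoc k E X Y (LinearMap.rTensor Y (galoisMap δX) (mulSnd k X Y (u ⊗ₜ v)))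
        = LinearMap.lTensor E (LinearMap.mulLeft k u)
          (TensorProduct.assoc k E X Y (LinearMap.rTensor Y δX.toLinearMap v)) := by
      intro u v
      induction v with
      | zero => simp
      | add x y hx hy => simp only [map_add, TensorProduct.tmul_add, hx, hy]
      | tmul x y =>
        induction u with
        | zero => simp
        | add p q hp hq =>
          rw [TensorProduct.add_tmul, map_add, map_add, map_add, hp, hq, ← LinearMap.add_apply,
            ← LinearMap.lTensor_add]
          congr 2
          ext
          simp [add_mul]
        | tmul p q =>
          simp only [mulSnd_tmul, LinearMap.rTensor_tmul, galoisMap_tmul,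
            AlgHom.toLinearMap_apply]
          induction δX x with
          | zero => simp
          | add x y hx hy => simp only [map_add, TensorProduct.add_tmul, hx, hy]
          | tmul e f => simp
    rw [diagCoact_tmul, h1, hco, galoisMap_tmul, ← LinearMap.comp_apply, ← LinearMap.comp_apply,
      ← LinearMap.lTensor_comp, ← LinearMap.lTensor_comp]
    congr 2
    ext z
    simp

/-- The Galois map as a specialization of the diagonal coaction. -/
lemma rTensor_counit_diagCoact (δ : X →ₐ[k] E ⊗[k] X) (ε : E →ₐ[k] k)
    (hε : ∀ x, TensorProduct.lid k X (LinearMap.rTensor X ε.toLinearMap (δ x)) = x)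
    (x : X ⊗[k] X) :
    LinearMap.rTensor X ((TensorProduct.lid k E).toLinearMap ∘ₗ
      LinearMap.rTensor E ε.toLinearMap) (diagCoact δ x) = galoisMap δ x := by
  induction x with
  | zero => simp
  | add x y hx hy => simp only [map_add, hx, hy]
  | tmul a b =>
    have h1 : ∀ u v : E ⊗[k] X,
        LinearMap.rTensor X ((TensorProduct.lid k E).toLinearMap ∘ₗ
          LinearMap.rTensor E ε.toLinearMap) (mulSnd k E X (u ⊗ₜ v))
        = LinearMap.lTensor E (LinearMap.mulLeft k
          (TensorProduct.lid k X (LinearMap.rTensor X ε.toLinearMap u))) v := by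
      intro u v
      induction v with
      | zero => simp
      | add x y hx hy => simp only [map_add, TensorProduct.tmul_add, hx, hy]
      | tmul x y =>
        induction u with
        | zero => simp
        | add p q hp hq =>
          simp only [map_add, TensorProduct.add_tmul, hp, hq]
          simp [add_mul, TensorProduct.tmul_add]
        | tmul p q => simp [TensorProduct.smul_tmul]
    rw [diagCoact_tmul, h1, hε, galoisMap_tmul]

lemma rTensor_mul'_diagCoact (Δ : Z →ₐ[k] X ⊗[k] Y) (x : Z ⊗[k] Z) :
    LinearMap.rTensor Y (LinearMap.mul' k X) (diagCoact Δ x) = Δ (LinearMap.mul' k Z x) := by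
  induction x with
  | zero => simp
  | add x y hx hy => simp only [map_add, hx, hy]
  | tmul a b =>
    rw [diagCoact_tmul, LinearMap.mul'_apply, map_mul]
    generalize Δ a = u
    generalize Δ b = v
    induction v with
    | zero => simp
    | add x y hx hy => simp only [map_add, TensorProduct.tmul_add, mul_add, hx, hy]
    | tmul x y =>
      induction u with
      | zero => simp
      | add p q hp hq => simp only [map_add, TensorProduct.add_tmul, add_mul, hp, hq]
      | tmul p q => simp

lemma rTensor_projA2_diagCoact (Δ : Z →ₐ[k] X ⊗[k] Y) (x : Z ⊗[k] Z) (hx : x ∈ A2sub k Z) :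
    LinearMap.rTensor Y (projA2 k X) (diagCoact Δ x) = diagCoact Δ x := by
  have h : LinearMap.mul' k Z x = 0 := hx
  rw [projA2, LinearMap.rTensor_sub, LinearMap.sub_apply, LinearMap.rTensor_comp,
    LinearMap.comp_apply, rTensor_mul'_diagCoact, h]
  simp

lemma rTensor_fodcMap_diagCoact_projA2 (sl : X →ₗ[k] Γ →ₗ[k] Γ) (d : X →ₗ[k] Γ) (hd : d 1 = 0)
    (Δ : Z →ₐ[k] X ⊗[k] Y) (x : Z ⊗[k] Z) :
    LinearMap.rTensor Y (fodcMap sl d) (diagCoact Δ (projA2 k Z x))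
      = LinearMap.rTensor Y (fodcMap sl d) (diagCoact Δ x) := by
  have key : ∀ c : Z, LinearMap.rTensor Y (fodcMap sl d) (diagCoact Δ (c ⊗ₜ 1)) = 0 := by
    intro c
    rw [diagCoact_tmul, map_one, Algebra.TensorProduct.one_def]
    induction Δ c with
    | zero => simp
    | add p q hp hq => simp only [map_add, TensorProduct.add_tmul, hp, hq, add_zero]
    | tmul p q => simp [hd]
  simp [projA2, key]

/-- Uniqueness of convolution inverses: a map whose convolution with the identity is `w ε`
is `w S`. -/
lemma eq_mul_antipode {ε : E →ₗ[k] k} {δ₁ : E →ₗ[k] X ⊗[k] B} {δ₂ : E →ₗ[k] B ⊗[k] X}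
    {lam : X →ₗ[k] E ⊗[k] X} {rho : X →ₗ[k] X ⊗[k] E}
    (hco : ∀ x, TensorProduct.assoc k X B X (LinearMap.rTensor X δ₁ (lam x))
      = LinearMap.lTensor X δ₂ (rho x))
    (hc₁ : ∀ x, TensorProduct.rid k X (LinearMap.lTensor X ε (rho x)) = x)
    (hc₂ : ∀ x, TensorProduct.lid k X (LinearMap.rTensor X ε (lam x)) = x)
    (S : X →ₗ[k] B)
    (hS : ∀ x, LinearMap.mul' k B (LinearMap.lTensor B S (δ₂ x)) = ε x • 1)
    (f : X →ₗ[k] B) (w : B)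
    (hf : ∀ x, LinearMap.mul' k B (LinearMap.rTensor B f (δ₁ x)) = ε x • w) (x : X) :
    f x = w * S x := by
  let M : X ⊗[k] (B ⊗[k] X) →ₗ[k] B :=
    LinearMap.mul' k B ∘ₗ TensorProduct.map f (LinearMap.mul' k B ∘ₗ LinearMap.lTensor B S)
  have h1 : ∀ v : X ⊗[k] E, M (LinearMap.lTensor X δ₂ v)
      = f (TensorProduct.rid k X (LinearMap.lTensor X ε v)) := by
    intro v
    induction v with
    | zero => simp
    | add p q hp hq => simp only [map_add, hp, hq]
    | tmul p q => simp [M, hS]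
  have h2 : ∀ (u : X ⊗[k] B) (r : X), M (TensorProduct.assoc k X B X (u ⊗ₜ r))
      = LinearMap.mul' k B (LinearMap.rTensor B f u) * S r := by
    intro u r
    induction u with
    | zero => simp
    | add p q hp hq => simp only [map_add, TensorProduct.add_tmul, add_mul, hp, hq]
    | tmul p q => simp [M, mul_assoc]
  have h3 : ∀ v : E ⊗[k] X, M (TensorProduct.assoc k X B X (LinearMap.rTensor X δ₁ v))
      = w * S (TensorProduct.lid k X (LinearMap.rTensor X ε v)) := by
    intro v
    induction v with
    | zero => simp
    | add p q hp hq => simp only [map_add, mul_add, hp, hq]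
    | tmul p q => simp [h2, hf]
  have := h1 (rho x)
  rw [hc₁, ← hco, h3, hc₂] at this
  exact this.symm

lemma antipode_anti_mul {ε : E →ₐ[k] k} {δ₁ : E →ₐ[k] X ⊗[k] B} {δ₂ : E →ₐ[k] B ⊗[k] X}
    {lam : X →ₐ[k] E ⊗[k] X} {rho : X →ₐ[k] X ⊗[k] E}
    (hco : ∀ x, TensorProduct.assoc k X B X (LinearMap.rTensor X δ₁.toLinearMap (lam x))
      = LinearMap.lTensor X δ₂.toLinearMap (rho x))
    (hc₁ : ∀ x, TensorProduct.rid k X (LinearMap.lTensor X ε.toLinearMap (rho x)) = x)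
    (hc₂ : ∀ x, TensorProduct.lid k X (LinearMap.rTensor X ε.toLinearMap (lam x)) = x)
    (S : X →ₗ[k] B)
    (hS₁ : ∀ x, LinearMap.mul' k B (LinearMap.rTensor B S (δ₁ x)) = ε x • 1)
    (hS₂ : ∀ x, LinearMap.mul' k B (LinearMap.lTensor B S (δ₂ x)) = ε x • 1) (a b : X) :
    S (a * b) = S b * S a := by
  have h1 : ∀ (e : E) (b : X),
      LinearMap.mul' k B (LinearMap.rTensor B (S ∘ₗ LinearMap.mulRight k b) (δ₁ e))
        = ε e • S b := by
    intro e b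
    let g : (X ⊗[k] B) →ₗ[k] X →ₗ[k] B :=
      LinearMap.mk₂ k (fun u b => LinearMap.mul' k B
          (LinearMap.rTensor B (S ∘ₗ LinearMap.mulRight k b) u))
        (fun u v b => by simp)
        (fun c u b => by simp)
        (fun u b c => by
          rw [← map_add, ← LinearMap.add_apply, ← LinearMap.rTensor_add, ← LinearMap.comp_add]
          congr 3
          ext
          simp [mul_add])
        (fun c u b => by
          rw [← map_smul, ← LinearMap.smul_apply, ← LinearMap.rTensor_smul, ← LinearMap.comp_smul]
          congr 3
          ext
          simp)
    have hg : ∀ u v : X ⊗[k] B, LinearMap.mul' k B (LinearMap.rTensor B (g u) v)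
        = LinearMap.mul' k B (LinearMap.rTensor B S (u * v)) := by
      intro u v
      induction v with
      | zero => simp
      | add p q hp hq => simp only [map_add, mul_add, hp, hq]
      | tmul p q =>
        induction u with
        | zero => simp
        | add x y hx hy =>
          simp only [map_add, add_mul, ← hx, ← hy]
          simp
        | tmul x y => simp [g, mul_assoc]
    have := eq_mul_antipode (δ₁ := δ₁.toLinearMap) (δ₂ := δ₂.toLinearMap) (lam := lam.toLinearMap)
      (rho := rho.toLinearMap) (ε := ε.toLinearMap) hco hc₁ hc₂ S hS₂ (g (δ₁ e)) (ε e • 1) (fun x => by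
      simp only [AlgHom.toLinearMap_apply]
      rw [hg, ← map_mul, hS₁, map_mul, smul_smul, mul_comm]) b
    simpa [g] using this
  exact eq_mul_antipode (δ₁ := δ₁.toLinearMap) (δ₂ := δ₂.toLinearMap) (lam := lam.toLinearMap)
      (rho := rho.toLinearMap) (ε := ε.toLinearMap) hco hc₁ hc₂ S hS₂ (S ∘ₗ LinearMap.mulRight k b) (S b)
    (fun x => h1 x b) a

lemma antipode_one {ε : E →ₐ[k] k} {δ₁ : E →ₐ[k] X ⊗[k] B} (S : X →ₗ[k] B)
    (hS₁ : ∀ x, LinearMap.mul' k B (LinearMap.rTensor B S (δ₁ x)) = ε x • 1) : S 1 = 1 := by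
  simpa [Algebra.TensorProduct.one_def] using hS₁ 1

/-- `x ⊗ c ↦ c T(x₂) ⊗ x₁`, the inverse of the Galois map when `T` is the inverse antipode. -/
noncomputable def galoisInv (δ₁ : E →ₐ[k] X ⊗[k] B) (T : B →ₗ[k] X) :
    E ⊗[k] X →ₗ[k] X ⊗[k] X :=
  TensorProduct.lift ((lmulTb k X).flip ∘ₗ (TensorProduct.comm k X X).toLinearMap ∘ₗ
    LinearMap.lTensor X T ∘ₗ δ₁.toLinearMap)

lemma galoisInv_tmul (δ₁ : E →ₐ[k] X ⊗[k] B) (T : B →ₗ[k] X) (x : E) (c : X) :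
    galoisInv δ₁ T (x ⊗ₜ c)
      = lmulTb k X c (TensorProduct.comm k X X (LinearMap.lTensor X T (δ₁ x))) := rfl

@[simp] lemma lmulTb_tmul (c a b : X) : lmulTb k X c (a ⊗ₜ b) = (c * a) ⊗ₜ b := rfl

@[simp] lemma rmulTb_tmul (c a b : X) : rmulTb k X c (a ⊗ₜ b) = a ⊗ₜ (b * c) := rfl

lemma galoisInv_galoisMap {ε : E →ₐ[k] k} {δ₁ : E →ₐ[k] X ⊗[k] B} {δ₂ : E →ₐ[k] B ⊗[k] X}
    {lam : X →ₐ[k] E ⊗[k] X} {rho : X →ₐ[k] X ⊗[k] E}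
    (hco : ∀ x, TensorProduct.assoc k X B X (LinearMap.rTensor X δ₁.toLinearMap (lam x))
      = LinearMap.lTensor X δ₂.toLinearMap (rho x))
    (hc₁ : ∀ x, TensorProduct.rid k X (LinearMap.lTensor X ε.toLinearMap (rho x)) = x)
    (T : B →ₗ[k] X)
    (hT : ∀ x, LinearMap.mul' k X (TensorProduct.comm k X X (LinearMap.rTensor X T (δ₂ x)))
      = ε x • 1) (x : X ⊗[k] X) :
    galoisInv δ₁ T (galoisMap lam x) = x := by
  induction x with
  | zero => simp
  | add x y hx hy => simp only [map_add, hx, hy]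
  | tmul a b =>
    let M : X ⊗[k] (B ⊗[k] X) →ₗ[k] X ⊗[k] X :=
      (TensorProduct.comm k X X).toLinearMap ∘ₗ LinearMap.lTensor X (LinearMap.mulLeft k a ∘ₗ
        LinearMap.mul' k X ∘ₗ (TensorProduct.comm k X X).toLinearMap ∘ₗ LinearMap.rTensor X T)
    have h1 : ∀ v : X ⊗[k] E, M (LinearMap.lTensor X δ₂.toLinearMap v)
        = a ⊗ₜ (TensorProduct.rid k X (LinearMap.lTensor X ε.toLinearMap v)) := by
      intro v
      induction v with
      | zero => simp
      | add p q hp hq => simp only [map_add, TensorProduct.tmul_add, hp, hq]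
      | tmul p q => simp [M, hT]
    have h2 : ∀ v : E ⊗[k] X,
        M (TensorProduct.assoc k X B X (LinearMap.rTensor X δ₁.toLinearMap v))
          = galoisInv δ₁ T (LinearMap.lTensor E (LinearMap.mulLeft k a) v) := by
      intro v
      induction v with
      | zero => simp
      | add p q hp hq => simp only [map_add, hp, hq]
      | tmul p q =>
        simp only [LinearMap.rTensor_tmul, LinearMap.lTensor_tmul, galoisInv_tmul,
          AlgHom.toLinearMap_apply]
        induction δ₁ p with
        | zero => simp
        | add p q hp hq => simp only [map_add, TensorProduct.add_tmul, hp, hq]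
        | tmul x y => simp [M, mul_assoc]
    rw [galoisMap_tmul, ← h2, hco, h1, hc₁]

/-- `x ⊗ y ↦ c T(y) x`. -/
noncomputable def twistAct {M : Type} [AddCommGroup M] [Module k M] (act : X →ₗ[k] M →ₗ[k] M)
    (T : B →ₗ[k] X) (c : X) : M ⊗[k] B →ₗ[k] M :=
  TensorProduct.lift (act ∘ₗ LinearMap.mulLeft k c ∘ₗ T).flip

@[simp] lemma twistAct_tmul {M : Type} [AddCommGroup M] [Module k M] (act : X →ₗ[k] M →ₗ[k] M)
    (T : B →ₗ[k] X) (c : X) (x : M) (y : B) : twistAct act T c (x ⊗ₜ y) = act (c * T y) x := rfl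

lemma map_twistAct {M M' : Type} [AddCommGroup M] [Module k M] [AddCommGroup M'] [Module k M']
    (act : X →ₗ[k] M →ₗ[k] M) (act' : X →ₗ[k] M' →ₗ[k] M') (f : M →ₗ[k] M')
    (hf : ∀ a x, f (act a x) = act' a (f x)) (T : B →ₗ[k] X) (c : X) (z : M ⊗[k] B) :
    f (twistAct act T c z) = twistAct act' T c (LinearMap.rTensor B f z) := by
  induction z with
  | zero => simp
  | add p q hp hq => simp only [map_add, hp, hq]
  | tmul p q => simp [hf]

lemma twistAct_diagCoact {ε : E →ₐ[k] k} {δ₁ : E →ₐ[k] X ⊗[k] B} (T : B →ₗ[k] X)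
    (hTm : ∀ a b, T (a * b) = T b * T a)
    (hT : ∀ x, LinearMap.mul' k X (TensorProduct.comm k X X (LinearMap.lTensor X T (δ₁ x)))
      = ε x • 1) (c : X) (x : E ⊗[k] E) :
    twistAct (lmulTb k X) T c (diagCoact δ₁ x)
      = galoisInv δ₁ T
        ((TensorProduct.lid k E (LinearMap.rTensor E ε.toLinearMap x)) ⊗ₜ c) := by
  induction x with
  | zero => simp
  | add x y hx hy => simp only [map_add, TensorProduct.add_tmul, hx, hy]
  | tmul a b =>
    have h1 : ∀ (u : X ⊗[k] B) (x : X) (y : B),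
        twistAct (lmulTb k X) T c (mulSnd k X B (u ⊗ₜ (x ⊗ₜ y)))
        = (c * (T y * LinearMap.mul' k X
            (TensorProduct.comm k X X (LinearMap.lTensor X T u)))) ⊗ₜ x := by
      intro u x y
      induction u with
      | zero => simp
      | add p q hp hq => simp only [map_add, TensorProduct.add_tmul, mul_add, hp, hq]
      | tmul p q => simp [hTm, mul_assoc]
    have h2 : ∀ v : X ⊗[k] B, twistAct (lmulTb k X) T c (mulSnd k X B (δ₁ a ⊗ₜ v))
        = ε a • lmulTb k X c (TensorProduct.comm k X X (LinearMap.lTensor X T v)) := by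
      intro v
      induction v with
      | zero => simp
      | add p q hp hq => simp only [map_add, TensorProduct.tmul_add, smul_add, hp, hq]
      | tmul p q => rw [h1, hT]; simp [TensorProduct.smul_tmul']
    rw [diagCoact_tmul, h2]
    simp [galoisInv_tmul]

end Coaction

section Calculi

variable {k : Type} [Field k]
variable {X Y Z E B Γ : Type} [Ring X] [Algebra k X] [Ring Y] [Algebra k Y]
  [Ring Z] [Algebra k Z] [Ring E] [Algebra k E] [Ring B] [Algebra k B]
  [AddCommGroup Γ] [Module k Γ]

lemma fodcMap_projA2 (sl : X →ₗ[k] Γ →ₗ[k] Γ) (d : X →ₗ[k] Γ) (hd : d 1 = 0) (x : X ⊗[k] X) :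
    fodcMap sl d (projA2 k X x) = fodcMap sl d x := by
  simp [projA2, hd]

lemma fodcMap_lmulTb (sl : X →ₗ[k] Γ →ₗ[k] Γ) (hsl : ∀ a b x, sl (a * b) x = sl a (sl b x))
    (d : X →ₗ[k] Γ) (c : X) (x : X ⊗[k] X) :
    fodcMap sl d (lmulTb k X c x) = sl c (fodcMap sl d x) := by
  induction x with
  | zero => simp
  | add x y hx hy => simp only [map_add, hx, hy]
  | tmul a b => simp [hsl]

lemma fodcMap_rmulTb (sl sr : X →ₗ[k] Γ →ₗ[k] Γ) (hsl : ∀ a b x, sl (a * b) x = sl a (sl b x))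
    (hslr : ∀ a b x, sl a (sr b x) = sr b (sl a x)) (d : X →ₗ[k] Γ)
    (hd : ∀ a b, d (a * b) = sr b (d a) + sl a (d b)) (c : X) (x : X ⊗[k] X) :
    fodcMap sl d (rmulTb k X c x)
      = sr c (fodcMap sl d x) + sl (LinearMap.mul' k X x) (d c) := by
  induction x with
  | zero => simp
  | add x y hx hy =>
    simp only [map_add, hx, hy, LinearMap.add_apply]
    abel
  | tmul a b => simp [hsl, hslr, hd]

lemma fodcMap_quotient (N : Submodule k (X ⊗[k] X))
    (hL : ∀ (c : X), ∀ x ∈ N, lmulTb k X c x ∈ N) (y : X ⊗[k] X) :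
    fodcMap (lactQ k X N hL) (dQ k X N) y
      = (N.comap (A2sub k X).subtype).mkQ ⟨projA2 k X y, projA2_mem y⟩ := by
  have : fodcMap (lactQ k X N hL) (dQ k X N)
      = (N.comap (A2sub k X).subtype).mkQ ∘ₗ
        LinearMap.codRestrict (A2sub k X) (projA2 k X) projA2_mem := by
    apply TensorProduct.ext'
    intro a b
    change Submodule.Quotient.mk _ = Submodule.Quotient.mk _
    congr 1
    ext
    simp [Dmap]
  rw [this]
  rfl

lemma dQ_one (N : Submodule k (X ⊗[k] X)) : dQ k X N 1 = 0 := by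
  change Submodule.Quotient.mk _ = _
  rw [Submodule.Quotient.mk_eq_zero]
  simp [Dmap]

lemma dQ_mul (N : Submodule k (X ⊗[k] X))
    (hL : ∀ (c : X), ∀ x ∈ N, lmulTb k X c x ∈ N)
    (hR : ∀ (c : X), ∀ x ∈ N, rmulTb k X c x ∈ N) (a b : X) :
    dQ k X N (a * b) = ractQ k X N hR b (dQ k X N a) + lactQ k X N hL a (dQ k X N b) := by
  change Submodule.Quotient.mk _ = Submodule.Quotient.mk _ + Submodule.Quotient.mk _
  rw [← Submodule.Quotient.mk_add]
  congr 1
  ext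
  simp [Dmap]

lemma mem_span_lactQ_dQ (N : Submodule k (X ⊗[k] X))
    (hL : ∀ (c : X), ∀ x ∈ N, lmulTb k X c x ∈ N)
    (x : A2sub k X ⧸ N.comap (A2sub k X).subtype) :
    x ∈ Submodule.span k {y | ∃ a b : X, y = lactQ k X N hL a (dQ k X N b)} := by
  have key : ∀ y : X ⊗[k] X, fodcMap (lactQ k X N hL) (dQ k X N) y
      ∈ Submodule.span k {y | ∃ a b : X, y = lactQ k X N hL a (dQ k X N b)} := by
    intro y
    induction y with
    | zero => simp
    | add p q hp hq => rw [map_add]; exact Submodule.add_mem _ hp hq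
    | tmul a b => exact Submodule.subset_span ⟨a, b, rfl⟩
  obtain ⟨⟨y, hy⟩, rfl⟩ := Submodule.mkQ_surjective _ x
  have h := key y
  rw [fodcMap_quotient] at h
  simpa only [projA2_of_mem hy] using h

lemma mul'_eq_zero_of_galoisMap_mem (δ : X →ₐ[k] E ⊗[k] X) (ε : E →ₐ[k] k)
    (hε : ∀ x, TensorProduct.lid k X (LinearMap.rTensor X ε.toLinearMap (δ x)) = x)
    (R : Submodule k E) (hR : ∀ x ∈ R, ε x = 0) (x : X ⊗[k] X)
    (hx : galoisMap δ x ∈ LinearMap.range (LinearMap.rTensor X R.subtype)) :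
    x ∈ A2sub k X := by
  obtain ⟨w, hw⟩ := hx
  have h0 : ε.toLinearMap ∘ₗ R.subtype = 0 := by
    ext y
    exact hR y y.2
  change LinearMap.mul' k X x = 0
  rw [← lid_rTensor_galoisMap δ ε hε, ← hw, ← LinearMap.comp_apply (LinearMap.rTensor X _),
    ← LinearMap.rTensor_comp, h0]
  simp

lemma galoisMap_lmulTb_mem (δ : X →ₐ[k] E ⊗[k] X) (R : Submodule k E) (c : X) (x : X ⊗[k] X)
    (hx : galoisMap δ x ∈ LinearMap.range (LinearMap.rTensor X R.subtype)) :
    galoisMap δ (lmulTb k X c x) ∈ LinearMap.range (LinearMap.rTensor X R.subtype) := by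
  obtain ⟨w, hw⟩ := hx
  refine ⟨LinearMap.lTensor R (LinearMap.mulLeft k c) w, ?_⟩
  rw [galoisMap_lmulTb, ← hw, ← LinearMap.comp_apply, ← LinearMap.comp_apply,
    LinearMap.rTensor_comp_lTensor, LinearMap.lTensor_comp_rTensor]

lemma galoisMap_rmulTb_mem (δ : X →ₐ[k] E ⊗[k] X) (R : Submodule k E)
    (hR : ∀ x ∈ R, ∀ a : E, x * a ∈ R) (c : X) (x : X ⊗[k] X)
    (hx : galoisMap δ x ∈ LinearMap.range (LinearMap.rTensor X R.subtype)) :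
    galoisMap δ (rmulTb k X c x) ∈ LinearMap.range (LinearMap.rTensor X R.subtype) := by
  obtain ⟨w, hw⟩ := hx
  rw [galoisMap_rmulTb, ← hw]
  clear hw
  induction w with
  | zero => simp
  | add p q hp hq => rw [map_add, add_mul]; exact Submodule.add_mem _ hp hq
  | tmul r y =>
    induction δ c with
    | zero => simp
    | add p q hp hq => rw [mul_add]; exact Submodule.add_mem _ hp hq
    | tmul e f => exact ⟨⟨r * e, hR r r.2 e⟩ ⊗ₜ (y * f), by simp⟩

lemma rTensor_diagCoact_eq_zero (δX : X →ₐ[k] E ⊗[k] X) (δZ : Z →ₐ[k] E ⊗[k] Z)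
    (Δ : Z →ₐ[k] X ⊗[k] Y)
    (hco : ∀ z, TensorProduct.assoc k E X Y (LinearMap.rTensor Y δX.toLinearMap (Δ z))
      = LinearMap.lTensor E Δ.toLinearMap (δZ z))
    (R : Submodule k E) (f : X ⊗[k] X →ₗ[k] Γ)
    (hf : ∀ y, galoisMap δX y ∈ LinearMap.range (LinearMap.rTensor X R.subtype) → f y = 0)
    (x : Z ⊗[k] Z) (hx : galoisMap δZ x ∈ LinearMap.range (LinearMap.rTensor Z R.subtype)) :
    LinearMap.rTensor Y f (diagCoact Δ x) = 0 := by
  refine rTensor_eq_zero_of_ker_le (LinearMap.rTensor X R.mkQ ∘ₗ galoisMap δX) f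
    (fun y hy => hf y ((mem_range_rTensor_subtype_iff R _).2 hy)) _ ?_
  have h : LinearMap.rTensor Z R.mkQ (galoisMap δZ x) = 0 :=
    (mem_range_rTensor_subtype_iff R _).1 hx
  have hassoc : ∀ z : (E ⊗[k] X) ⊗[k] Y,
      TensorProduct.assoc k (E ⧸ R) X Y (LinearMap.rTensor Y (LinearMap.rTensor X R.mkQ) z)
        = LinearMap.rTensor (X ⊗[k] Y) R.mkQ (TensorProduct.assoc k E X Y z) := by
    intro z
    rw [LinearMap.rTensor_tensor]
    simp
  apply (TensorProduct.assoc k (E ⧸ R) X Y).injective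
  rw [LinearMap.rTensor_comp, LinearMap.comp_apply, hassoc,
    assoc_rTensor_galoisMap δX δZ Δ hco, ← LinearMap.comp_apply,
    LinearMap.rTensor_comp_lTensor, ← LinearMap.lTensor_comp_rTensor, LinearMap.comp_apply, h]
  simp

lemma galoisMap_mem_range (δ : X →ₐ[k] E ⊗[k] X) (ε : E →ₐ[k] k)
    (hε : ∀ x, TensorProduct.lid k X (LinearMap.rTensor X ε.toLinearMap (δ x)) = x)
    (R : Submodule k E) (φ : E ⊗[k] E →ₗ[k] Γ) (hφ : ∀ y, φ (projA2 k E y) = φ y)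
    (hR : ∀ y ∈ A2sub k E, φ y = 0 →
      TensorProduct.lid k E (LinearMap.rTensor E ε.toLinearMap y) ∈ R)
    (x : X ⊗[k] X) (hx : x ∈ A2sub k X) (hz : LinearMap.rTensor X φ (diagCoact δ x) = 0) :
    galoisMap δ x ∈ LinearMap.range (LinearMap.rTensor X R.subtype) := by
  rw [mem_range_rTensor_subtype_iff, ← rTensor_counit_diagCoact δ ε hε,
    ← rTensor_projA2_diagCoact δ x hx, ← LinearMap.comp_apply, ← LinearMap.comp_apply,
    ← LinearMap.rTensor_comp, ← LinearMap.rTensor_comp]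
  refine rTensor_eq_zero_of_ker_le φ _ (fun y hy => ?_) _ hz
  have := hR (projA2 k E y) (projA2_mem y) ((hφ y).trans hy)
  simpa using this

lemma galoisInv_mem {ε : E →ₐ[k] k} {δ₁ : E →ₐ[k] X ⊗[k] B} (T : B →ₗ[k] X)
    (hTm : ∀ a b, T (a * b) = T b * T a)
    (hT : ∀ x, LinearMap.mul' k X (TensorProduct.comm k X X (LinearMap.lTensor X T (δ₁ x)))
      = ε x • 1)
    (sl : X →ₗ[k] Γ →ₗ[k] Γ) (hsl : ∀ a b x, sl (a * b) x = sl a (sl b x)) (d : X →ₗ[k] Γ)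
    (y : E ⊗[k] E) (hy : y ∈ A2sub k E)
    (hz : LinearMap.rTensor B (fodcMap sl d) (diagCoact δ₁ y) = 0) (c : X) :
    galoisInv δ₁ T ((TensorProduct.lid k E (LinearMap.rTensor E ε.toLinearMap y)) ⊗ₜ c)
      ∈ LinearMap.ker (fodcMap sl d) ⊓ A2sub k X := by
  have hy' : LinearMap.mul' k E y = 0 := hy
  rw [← twistAct_diagCoact T hTm hT]
  constructor
  · change fodcMap sl d _ = 0
    rw [map_twistAct _ sl _ (fodcMap_lmulTb sl hsl d), hz, map_zero]
  · change LinearMap.mul' k X _ = 0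
    rw [map_twistAct _ (LinearMap.mul k X) (LinearMap.mul' k X), rTensor_mul'_diagCoact, hy',
      map_zero, map_zero]
    intro a x
    induction x with
    | zero => simp
    | add p q hp hq => simp only [map_add, hp, hq]
    | tmul p q => simp [mul_assoc]

end Calculi

/-- Classification of right covariant `π`-graded first order
differential calculi (antipodes assumed bijective): for a right ideal `R ⊆ ker ε` of
`A₁`, the family `N_α = t_α⁻¹(R ⊗ A_α)` consists of sub-bimodules of `A_α²` and the
quotient calculus `(A²/N, π ∘ D)` is right covariant; conversely, every right covariant
`π`-graded first order differential calculus over `A` is isomorphic to one of this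
form. -/
theorem right_covariant_fodc_classification
    {k : Type} [Field k] {G : Type} [Group G]
    (A : G → Type) [∀ α, Ring (A α)] [∀ α, Algebra k (A α)]
    (Δ : ∀ α β γ : G, α * β = γ → (A γ →ₐ[k] A α ⊗[k] A β))
    (ε : A 1 →ₐ[k] k)
    (S : ∀ α β : G, α⁻¹ = β → (A α →ₗ[k] A β))
    (hcoassoc : ∀ (α β γ : G) (x : A (α * β * γ)),
      (TensorProduct.assoc k (A α) (A β) (A γ))
          ((Algebra.TensorProduct.map (Δ α β (α * β) rfl) (AlgHom.id k (A γ)))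
            ((Δ (α * β) γ (α * β * γ) rfl) x))
        = (Algebra.TensorProduct.map (AlgHom.id k (A α)) (Δ β γ (β * γ) rfl))
            ((Δ α (β * γ) (α * β * γ) (mul_assoc α β γ).symm) x))
    (hcounit₁ : ∀ (α : G) (x : A α),
      (TensorProduct.rid k (A α)) ((LinearMap.lTensor (A α) ε.toLinearMap)
        ((Δ α 1 α (mul_one α)) x)) = x)
    (hcounit₂ : ∀ (α : G) (x : A α),
      (TensorProduct.lid k (A α)) ((LinearMap.rTensor (A α) ε.toLinearMap)
        ((Δ 1 α α (one_mul α)) x)) = x)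
    (hantipode₁ : ∀ (α : G) (x : A 1),
      (LinearMap.mul' k (A α)) ((LinearMap.rTensor (A α) (S α⁻¹ α (inv_inv α)))
        ((Δ α⁻¹ α 1 (inv_mul_cancel α)) x)) = ε x • 1)
    (hantipode₂ : ∀ (α : G) (x : A 1),
      (LinearMap.mul' k (A α)) ((LinearMap.lTensor (A α) (S α⁻¹ α (inv_inv α)))
        ((Δ α α⁻¹ 1 (mul_inv_cancel α)) x)) = ε x • 1)
    (hS : ∀ α : G, Function.Bijective (S α α⁻¹ rfl))
    -- a right ideal `R` of `A₁` contained in `ker ε`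
    (Rid : Submodule k (A 1))
    (hRid_ideal : ∀ x ∈ Rid, ∀ a : A 1, x * a ∈ Rid)
    (hRid_ker : ∀ x ∈ Rid, ε x = 0)
    -- an arbitrary right covariant π-graded first order differential calculus
    (Γ : G → Type) [∀ α, AddCommGroup (Γ α)] [∀ α, Module k (Γ α)]
    (sl sr : ∀ α, A α →ₗ[k] Γ α →ₗ[k] Γ α)
    (hsl_one : ∀ (α : G) (x : Γ α), sl α 1 x = x)
    (hsl_mul : ∀ (α : G) (a b : A α) (x : Γ α), sl α (a * b) x = sl α a (sl α b x))
    (hsr_one : ∀ (α : G) (x : Γ α), sr α 1 x = x)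
    (hsr_mul : ∀ (α : G) (a b : A α) (x : Γ α), sr α (a * b) x = sr α b (sr α a x))
    (hslr : ∀ (α : G) (a b : A α) (x : Γ α), sl α a (sr α b x) = sr α b (sl α a x))
    (d : ∀ α, A α →ₗ[k] Γ α)
    (hLeibniz : ∀ (α : G) (a b : A α), d α (a * b) = sr α b (d α a) + sl α a (d α b))
    (hgen : ∀ (α : G) (x : Γ α),
      x ∈ Submodule.span k {y : Γ α | ∃ a b : A α, y = sl α a (d α b)})
    (hrcov : ∀ (α β : G) (n : ℕ) (a b : Fin n → A (α * β)),
      (∑ i, sl (α * β) (a i) (d (α * β) (b i))) = 0 →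
      (∑ i, tact (sl α) (LinearMap.mul k (A β)) ((Δ α β (α * β) rfl) (a i))
          ((LinearMap.rTensor (A β) (d α)) ((Δ α β (α * β) rfl) (b i)))) = 0) :
    -- Forward: each `N_α` is a sub-bimodule of `A_α²` and the quotient calculus is
    -- right covariant.
    ((∀ α : G, NofT A Δ Rid α ≤ A2sub k (A α))
      ∧ ∃ (hL : ∀ (α : G) (c : A α), ∀ x ∈ NofT A Δ Rid α,
            lmulTb k (A α) c x ∈ NofT A Δ Rid α)
          (hR : ∀ (α : G) (c : A α), ∀ x ∈ NofT A Δ Rid α,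
            rmulTb k (A α) c x ∈ NofT A Δ Rid α),
        (∀ (α : G) (a b : A α),
          dQ k (A α) (NofT A Δ Rid α) (a * b)
            = ractQ k (A α) (NofT A Δ Rid α) (hR α) b
                (dQ k (A α) (NofT A Δ Rid α) a)
              + lactQ k (A α) (NofT A Δ Rid α) (hL α) a
                  (dQ k (A α) (NofT A Δ Rid α) b))
        ∧ (∀ (α : G) (x : A2sub k (A α) ⧸
              (NofT A Δ Rid α).comap (A2sub k (A α)).subtype),
            x ∈ Submodule.span k {y | ∃ a b : A α,
              y = lactQ k (A α) (NofT A Δ Rid α) (hL α) a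
                    (dQ k (A α) (NofT A Δ Rid α) b)})
        ∧ (∀ (α β : G) (n : ℕ) (a b : Fin n → A (α * β)),
          (∑ i, lactQ k (A (α * β)) (NofT A Δ Rid (α * β)) (hL (α * β)) (a i)
            (dQ k (A (α * β)) (NofT A Δ Rid (α * β)) (b i))) = 0 →
          (∑ i, tact (lactQ k (A α) (NofT A Δ Rid α) (hL α)) (LinearMap.mul k (A β))
              ((Δ α β (α * β) rfl) (a i))
              ((LinearMap.rTensor (A β) (dQ k (A α) (NofT A Δ Rid α)))
                ((Δ α β (α * β) rfl) (b i)))) = 0))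
    ∧
    -- Converse: every right covariant π-graded first order differential
    -- calculus arises, up to isomorphism, from such a right ideal.
    (∃ Rid' : Submodule k (A 1),
      (∀ x ∈ Rid', ∀ a : A 1, x * a ∈ Rid')
      ∧ (∀ x ∈ Rid', ε x = 0)
      ∧ (∀ α : G, NofT A Δ Rid' α ≤ A2sub k (A α))
      ∧ ∃ (hL : ∀ (α : G) (c : A α), ∀ x ∈ NofT A Δ Rid' α,
            lmulTb k (A α) c x ∈ NofT A Δ Rid' α)
          (hR : ∀ (α : G) (c : A α), ∀ x ∈ NofT A Δ Rid' α,
            rmulTb k (A α) c x ∈ NofT A Δ Rid' α)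
          (e : ∀ α : G, (A2sub k (A α) ⧸
            (NofT A Δ Rid' α).comap (A2sub k (A α)).subtype) ≃ₗ[k] Γ α),
        (∀ (α : G) (c : A α) x,
          e α (lactQ k (A α) (NofT A Δ Rid' α) (hL α) c x) = sl α c (e α x))
        ∧ (∀ (α : G) (c : A α) x,
          e α (ractQ k (A α) (NofT A Δ Rid' α) (hR α) c x) = sr α c (e α x))
        ∧ (∀ (α : G) (a : A α),
          e α (dQ k (A α) (NofT A Δ Rid' α) a) = d α a)) := by
  have hco : ∀ (α β γ p q r : G) (h1 : α * β = p) (h2 : p * γ = q) (h3 : β * γ = r)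
      (h4 : α * r = q) (x : A q),
      TensorProduct.assoc k (A α) (A β) (A γ)
        (LinearMap.rTensor (A γ) (Δ α β p h1).toLinearMap (Δ p γ q h2 x))
      = LinearMap.lTensor (A α) (Δ β γ r h3).toLinearMap (Δ α r q h4 x) := by
    intro α β γ p q r h1 h2 h3 h4 x
    subst h1 h2 h3
    exact hcoassoc α β γ x
  have hcov : ∀ (α β γ : G) (h : α * β = γ) (x : A γ ⊗[k] A γ), fodcMap (sl γ) (d γ) x = 0 →
      LinearMap.rTensor (A β) (fodcMap (sl α) (d α)) (diagCoact (Δ α β γ h) x) = 0 := by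
    intro α β γ h x hx
    subst h
    obtain ⟨n, a, b, rfl⟩ := TensorProduct.exists_sum_tmul_eq x
    rw [← sum_tact]
    exact hrcov α β n a b (by rw [← fodcMap_sum, hx])
  have hd1 : ∀ α, d α 1 = 0 := by
    intro α
    simpa [hsl_one, hsr_one] using hLeibniz α 1 1
  have hA2 : ∀ R : Submodule k (A 1), (∀ x ∈ R, ε x = 0) →
      ∀ α, NofT A Δ R α ≤ A2sub k (A α) := fun R hR α x hx =>
    mul'_eq_zero_of_galoisMap_mem (Δ 1 α α (one_mul α)) ε (hcounit₂ α) R hR x hx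
  have hL : ∀ (R : Submodule k (A 1)) (α : G) (c : A α), ∀ x ∈ NofT A Δ R α,
      lmulTb k (A α) c x ∈ NofT A Δ R α := fun R α c x hx =>
    galoisMap_lmulTb_mem (Δ 1 α α (one_mul α)) R c x hx
  have hR : ∀ (R : Submodule k (A 1)), (∀ x ∈ R, ∀ a : A 1, x * a ∈ R) →
      ∀ (α : G) (c : A α), ∀ x ∈ NofT A Δ R α,
      rmulTb k (A α) c x ∈ NofT A Δ R α := fun R hR α c x hx =>
    galoisMap_rmulTb_mem (Δ 1 α α (one_mul α)) R hR c x hx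
  refine ⟨⟨hA2 Rid hRid_ker, hL Rid, hR Rid hRid_ideal, fun α => dQ_mul _ _ _,
    fun α => mem_span_lactQ_dQ _ _, ?_⟩, ?_⟩
  · intro α β n a b hab
    rw [sum_tact, ← rTensor_fodcMap_diagCoact_projA2 _ _ (dQ_one _)]
    rw [← fodcMap_sum, fodcMap_quotient, Submodule.mkQ_apply, Submodule.Quotient.mk_eq_zero] at hab
    refine rTensor_diagCoact_eq_zero (Δ 1 α α (one_mul α)) (Δ 1 (α * β) (α * β) (one_mul _))
      (Δ α β (α * β) rfl) (hco _ _ _ _ _ _ _ _ _ _) Rid _ (fun y hy => ?_) _ hab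
    rw [fodcMap_quotient, Submodule.mkQ_apply, Submodule.Quotient.mk_eq_zero]
    change projA2 k (A α) y ∈ NofT A Δ Rid α
    rw [projA2_of_mem (hA2 Rid hRid_ker α hy)]
    exact hy
  · have hanti₁ : ∀ (α β : G) (h : α⁻¹ = β) (h' : α * β = 1) (x : A 1),
        LinearMap.mul' k (A β) (LinearMap.rTensor (A β) (S α β h) (Δ α β 1 h' x)) = ε x • 1 := by
      intro α β h h' x
      obtain rfl : β⁻¹ = α := by rw [← h, inv_inv]
      exact hantipode₁ β x
    have hanti₂ : ∀ (α β : G) (h : α⁻¹ = β) (h' : β * α = 1) (x : A 1),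
        LinearMap.mul' k (A β) (LinearMap.lTensor (A β) (S α β h) (Δ β α 1 h' x)) = ε x • 1 := by
      intro α β h h' x
      obtain rfl : β⁻¹ = α := by rw [← h, inv_inv]
      exact hantipode₂ β x
    have hSmul : ∀ (α : G) (a b : A α),
        S α α⁻¹ rfl (a * b) = S α α⁻¹ rfl b * S α α⁻¹ rfl a := fun α a b =>
      antipode_anti_mul (δ₁ := Δ α α⁻¹ 1 (mul_inv_cancel α)) (δ₂ := Δ α⁻¹ α 1 (inv_mul_cancel α))
        (hco α α⁻¹ α 1 α 1 _ (one_mul α) _ (mul_one α)) (hcounit₁ α) (hcounit₂ α) _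
        (hanti₁ _ _ _ _) (hanti₂ _ _ _ _) a b
    have hSone : ∀ α : G, S α α⁻¹ rfl 1 = 1 := fun α =>
      antipode_one (δ₁ := Δ α α⁻¹ 1 (mul_inv_cancel α)) _ (hanti₁ _ _ _ _)
    let e : ∀ α, A α ≃ₗ[k] A α⁻¹ := fun α => LinearEquiv.ofBijective (S α α⁻¹ rfl) (hS α)
    let T : ∀ α, A α⁻¹ →ₗ[k] A α := fun α => (e α).symm.toLinearMap
    have hST : ∀ α x, S α α⁻¹ rfl (T α x) = x := fun α x => (e α).apply_symm_apply x
    have hTm : ∀ α a b, T α (a * b) = T α b * T α a := by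
      intro α a b
      apply (hS α).injective
      rw [hSmul, hST, hST, hST]
    have hT₁ : ∀ (α : G) (x : A 1), LinearMap.mul' k (A α) (TensorProduct.comm k _ _
        (LinearMap.lTensor (A α) (T α) (Δ α α⁻¹ 1 (mul_inv_cancel α) x))) = ε x • 1 := by
      intro α x
      apply (hS α).injective
      rw [map_smul, hSone, ← hanti₁ α α⁻¹ rfl (mul_inv_cancel α)]
      induction Δ α α⁻¹ 1 (mul_inv_cancel α) x with
      | zero => simp
      | add p q hp hq => simp only [map_add, hp, hq]
      | tmul p q => simp [hSmul, hST]
    have hT₂ : ∀ (α : G) (x : A 1), LinearMap.mul' k (A α) (TensorProduct.comm k _ _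
        (LinearMap.rTensor (A α) (T α) (Δ α⁻¹ α 1 (inv_mul_cancel α) x))) = ε x • 1 := by
      intro α x
      apply (hS α).injective
      rw [map_smul, hSone, ← hanti₂ α α⁻¹ rfl (inv_mul_cancel α)]
      induction Δ α⁻¹ α 1 (inv_mul_cancel α) x with
      | zero => simp
      | add p q hp hq => simp only [map_add, hp, hq]
      | tmul p q => simp [hSmul, hST]
    let K : ∀ α, Submodule k (A α ⊗[k] A α) := fun α =>
      LinearMap.ker (fodcMap (sl α) (d α)) ⊓ A2sub k (A α)
    let π : A 1 ⊗[k] A 1 →ₗ[k] A 1 :=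
      (TensorProduct.lid k (A 1)).toLinearMap ∘ₗ LinearMap.rTensor (A 1) ε.toLinearMap
    let R : Submodule k (A 1) := (K 1).map π
    have hRideal : ∀ x ∈ R, ∀ a : A 1, x * a ∈ R := by
      rintro _ ⟨y, hy, rfl⟩ a
      have hy2 : LinearMap.mul' k (A 1) y = 0 := hy.2
      refine ⟨rmulTb k (A 1) a y, ⟨?_, rmulTb_mem_A2sub k (A 1) a y hy.2⟩, ?_⟩
      · change fodcMap (sl 1) (d 1) _ = 0
        rw [fodcMap_rmulTb (sl 1) (sr 1) (hsl_mul 1) (hslr 1) (d 1) (hLeibniz 1), hy2,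
          show fodcMap (sl 1) (d 1) y = 0 from hy.1]
        simp
      · clear hy hy2
        induction y with
        | zero => simp
        | add p q hp hq => simp only [map_add, add_mul, hp, hq]
        | tmul p q => simp [π]
    have hRker : ∀ x ∈ R, ε x = 0 := by
      rintro _ ⟨y, hy, rfl⟩
      have hy2 : LinearMap.mul' k (A 1) y = 0 := hy.2
      have : ε (π y) = ε (LinearMap.mul' k (A 1) y) := by
        clear hy hy2
        induction y with
        | zero => simp
        | add p q hp hq => simp only [map_add, hp, hq]
        | tmul p q => simp [π]
      rw [this, hy2, map_zero]
    have hNK : ∀ α, NofT A Δ R α = K α := by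
      intro α
      apply le_antisymm
      · intro x hx
        obtain ⟨w, hw⟩ : galoisMap (Δ 1 α α (one_mul α)) x
          ∈ LinearMap.range (LinearMap.rTensor (A α) R.subtype) := hx
        rw [← galoisInv_galoisMap (δ₁ := Δ α α⁻¹ 1 (mul_inv_cancel α))
          (δ₂ := Δ α⁻¹ α 1 (inv_mul_cancel α)) (hco α α⁻¹ α 1 α 1 _ (one_mul α) _ (mul_one α))
          (hcounit₁ α) (T α) (hT₂ α) x, ← hw]
        clear hw
        induction w with
        | zero => simp
        | add p q hp hq => rw [map_add, map_add]; exact Submodule.add_mem _ hp hq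
        | tmul r c =>
          obtain ⟨_, y, hy, rfl⟩ := r
          exact galoisInv_mem (T α) (hTm α) (hT₁ α) (sl α) (hsl_mul α) (d α) y hy.2
            (hcov _ _ _ _ y hy.1) c
      · intro x hx
        exact galoisMap_mem_range (Δ 1 α α (one_mul α)) ε (hcounit₂ α) R
          (fodcMap (sl 1) (d 1)) (fodcMap_projA2 _ _ (hd1 1))
          (fun y hy hy' => ⟨y, ⟨hy', hy⟩, rfl⟩) x hx.2 (hcov _ _ _ _ x hx.1)
    let f : ∀ α, A2sub k (A α) →ₗ[k] Γ α := fun α =>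
      fodcMap (sl α) (d α) ∘ₗ (A2sub k (A α)).subtype
    have hfker : ∀ α, (NofT A Δ R α).comap (A2sub k (A α)).subtype = LinearMap.ker (f α) := by
      intro α
      ext x
      rw [hNK]
      exact ⟨fun h => h.1, fun h => ⟨h, x.2⟩⟩
    have hfsurj : ∀ α, Function.Surjective (f α) := by
      intro α
      rw [← LinearMap.range_eq_top, eq_top_iff]
      intro x _
      refine Submodule.span_le.2 ?_ (hgen α x)
      rintro _ ⟨a, b, rfl⟩
      exact ⟨⟨projA2 k (A α) (a ⊗ₜ b), projA2_mem _⟩, fodcMap_projA2 (sl α) (d α) (hd1 α) (a ⊗ₜ b)⟩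
    refine ⟨R, hRideal, hRker, hA2 R hRker, hL R, hR R hRideal,
      fun α => Submodule.quotEquivOfEq _ _ (hfker α) ≪≫ₗ
        (f α).quotKerEquivOfSurjective (hfsurj α), ?_, ?_, ?_⟩
    · intro α c x
      obtain ⟨x, rfl⟩ := Submodule.mkQ_surjective _ x
      exact fodcMap_lmulTb (sl α) (hsl_mul α) (d α) c x
    · intro α c x
      obtain ⟨x, rfl⟩ := Submodule.mkQ_surjective _ x
      refine (fodcMap_rmulTb (sl α) (sr α) (hsl_mul α) (hslr α) (d α) (hLeibniz α) c x).trans ?_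
      rw [show LinearMap.mul' k (A α) x = 0 from x.2, map_zero, LinearMap.zero_apply, add_zero]
      rfl
    · intro α a
      change fodcMap (sl α) (d α) (Dmap k (A α) a) = d α a
      simp [Dmap, hd1, hsl_one]
end
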